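/- arXiv:2301.00708 — 2 statements merged into one kernel-verified Lean document; each statement's English description precedes it below -/
import Mathlib

section
/- Let R be a ring and S a class of finitely presented right R-modules containing the free module R and closed under extensions and kernels of epimorphisms. Put B = S^{⊥₁}, A = ^{⊥₁}B, and C = lim→ S. Let A^• be a complex of right R-modules whose terms belong to A, and let X^• be an acyclic complex of right R-modules whose terms belong to B ∩ C and whose modules of cocycles also belong to B ∩ C. Then any morphism of complexes A^• → X^• is homotopic to zero. -/
open CategoryTheory CategoryTheory.Limits

universe w v u

namespace GenPeriodicity

variable {K : Type u} [Category.{v} K]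

section AbelianDefs

variable [Abelian K]

/-- `Ext¹(X, Y) = 0`, expressed by the splitting of all short exact sequences
`0 → Y → E → X → 0`. -/
def Ext1Zero (X Y : K) : Prop :=
  ∀ (E : K) (i : Y ⟶ E) (p : E ⟶ X) (w : i ≫ p = 0),
    (ShortComplex.mk i p w).ShortExact → ∃ s : X ⟶ E, s ≫ p = 𝟙 X

/-- The right `Ext¹`-orthogonal class `S^{⊥₁}`. -/
def rightPerp (S : Set K) : Set K := {B | ∀ X ∈ S, Ext1Zero X B}

/-- The left `Ext¹`-orthogonal class `^{⊥₁}B`. -/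
def leftPerp (B : Set K) : Set K := {A | ∀ Y ∈ B, Ext1Zero A Y}

/-- A class of objects is closed under extensions. -/
def ClosedUnderExtensions (C : Set K) : Prop :=
  ∀ (X : ShortComplex K), X.ShortExact → X.X₁ ∈ C → X.X₃ ∈ C → X.X₂ ∈ C

/-- A class of objects is closed under kernels of epimorphisms. -/
def ClosedUnderKernelsOfEpis (C : Set K) : Prop :=
  ∀ (X : ShortComplex K), X.ShortExact → X.X₂ ∈ C → X.X₃ ∈ C → X.X₁ ∈ C

/-- A class of objects is closed under direct summands (retracts). -/
def ClosedUnderDirectSummands (C : Set K) : Prop :=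
  ∀ X ∈ C, ∀ (Y : K) (s : Y ⟶ X) (r : X ⟶ Y), s ≫ r = 𝟙 Y → Y ∈ C

/-- A (doubly unbounded) complex is acyclic if it is exact at every term. -/
def IsAcyclic (X : CochainComplex K ℤ) : Prop := ∀ n : ℤ, X.ExactAt n

end AbelianDefs

/-- Data exhibiting `M` as a direct limit (over a directed poset) of objects from `S`. -/
structure DirectSystemTo (S : Set K) (M : K) where
  I : Type v
  [po : PartialOrder I]
  dir : IsDirected I (· ≤ ·)
  ne : Nonempty I
  F : I ⥤ K
  mem : ∀ i, F.obj i ∈ S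
  c : Cocone F
  hc : IsColimit c
  iso : c.pt ≅ M

/-- `lim→ S`: the class of all direct limits of direct systems of objects of `S`
indexed by directed posets. -/
def limClosure (S : Set K) : Set K := {M | Nonempty (DirectSystemTo S M)}

/-- A class of objects is closed under direct limits (indexed by directed posets). -/
def ClosedUnderDirectLimits (C : Set K) : Prop :=
  ∀ (I : Type v) [PartialOrder I], IsDirected I (· ≤ ·) → Nonempty I →
    ∀ (F : I ⥤ K), (∀ i, F.obj i ∈ C) → ∀ (c : Cocone F), IsColimit c → c.pt ∈ C

/-- A class of objects is closed under (set-indexed) coproducts. -/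
def ClosedUnderCoproducts (C : Set K) : Prop :=
  ∀ (B : Type v) (X : B → K), (∀ b, X b ∈ C) → ∀ (c : Cofan X), IsColimit c → c.pt ∈ C

section Modules

variable {R : Type u} [Ring R]

/-- A class of finitely presented modules containing the zero modules and the regular module,
and closed under extensions. -/
structure Admissible (S : Set (ModuleCat.{u} R)) : Prop where
  zero : ∀ (M : Type u) [AddCommGroup M] [Module R M] [Subsingleton M], ModuleCat.of R M ∈ S
  ext : ∀ {M N P : Type u} [AddCommGroup M] [Module R M] [AddCommGroup N] [Module R N]
    [AddCommGroup P] [Module R P] (f : M →ₗ[R] N) (g : N →ₗ[R] P), Function.Injective f →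
    Function.Exact f g → Function.Surjective g →
    ModuleCat.of R M ∈ S → ModuleCat.of R P ∈ S → ModuleCat.of R N ∈ S
  fp : ∀ (M : Type u) [AddCommGroup M] [Module R M], ModuleCat.of R M ∈ S →
    Module.FinitePresentation R M
  free : ModuleCat.of R R ∈ S

theorem Admissible.of_linearEquiv {S : Set (ModuleCat.{u} R)} (hS : Admissible S) {M N : Type u}
    [AddCommGroup M] [Module R M] [AddCommGroup N] [Module R N] (e : M ≃ₗ[R] N)
    (hM : ModuleCat.of R M ∈ S) : ModuleCat.of R N ∈ S :=
  hS.ext e.toLinearMap (0 : N →ₗ[R] PUnit.{u + 1}) e.injective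
    (fun y => ⟨fun _ => e.surjective y, fun _ => rfl⟩) (fun _ => ⟨0, rfl⟩) hM (hS.zero _)

theorem shortExact_of_linearMap {M N P : Type u} [AddCommGroup M] [Module R M] [AddCommGroup N]
    [Module R N] [AddCommGroup P] [Module R P] (f : M →ₗ[R] N) (g : N →ₗ[R] P)
    (hf : Function.Injective f) (hfg : Function.Exact f g) (hg : Function.Surjective g)
    (w : ModuleCat.ofHom f ≫ ModuleCat.ofHom g = 0) :
    (ShortComplex.mk (ModuleCat.ofHom f) (ModuleCat.ofHom g) w).ShortExact :=
  ModuleCat.shortComplex_shortExact _ hfg hf hg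

theorem admissible_of_closed {S : Set (ModuleCat.{u} R)}
    (hfp : ∀ M ∈ S, Module.FinitePresentation R M) (hfree : ModuleCat.of R R ∈ S)
    (hext : ClosedUnderExtensions S) (hker : ClosedUnderKernelsOfEpis S) : Admissible S where
  zero M _ _ _ := hker
    (.mk (ModuleCat.ofHom (0 : M →ₗ[R] R)) (ModuleCat.ofHom (LinearMap.id : R →ₗ[R] R)) rfl)
    (shortExact_of_linearMap _ _ (Function.injective_of_subsingleton _)
      (fun y => ⟨fun h => ⟨0, h.symm⟩, fun ⟨_, h⟩ => h.symm⟩) (fun y => ⟨y, rfl⟩) rfl) hfree hfree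
  ext f g hf hfg hg hM hP := hext
    (.mk (ModuleCat.ofHom f) (ModuleCat.ofHom g) (by
      ext x
      exact (hfg _).2 ⟨x, rfl⟩))
    (shortExact_of_linearMap f g hf hfg hg _) hM hP
  fp M _ _ hM := hfp _ hM
  free := hfree

section ExtOne

variable {M B E Q : Type u} [AddCommGroup M] [Module R M] [AddCommGroup B] [Module R B]
  [AddCommGroup E] [Module R E] [AddCommGroup Q] [Module R Q]

theorem Ext1Zero.exists_section (h : Ext1Zero (ModuleCat.of R M) (ModuleCat.of R B))
    (i : B →ₗ[R] E) (p : E →ₗ[R] M) (hi : Function.Injective i) (hip : Function.Exact i p)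
    (hp : Function.Surjective p) : ∃ s : M →ₗ[R] E, ∀ x, p (s x) = x := by
  have w : ModuleCat.ofHom i ≫ ModuleCat.ofHom p = 0 := by
    ext x
    exact (hip _).2 ⟨x, rfl⟩
  obtain ⟨s, hs⟩ := h (ModuleCat.of R E) _ _ w (shortExact_of_linearMap i p hi hip hp w)
  exact ⟨s.hom, fun x => congrArg (fun t => t.hom x) hs⟩

theorem Ext1Zero.exists_lift (h : Ext1Zero (ModuleCat.of R M) (ModuleCat.of R B))
    (i : B →ₗ[R] E) (p : E →ₗ[R] Q) (hi : Function.Injective i) (hip : Function.Exact i p)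
    (hp : Function.Surjective p) (f : M →ₗ[R] Q) : ∃ s : M →ₗ[R] E, ∀ x, p (s x) = f x := by
  let P : Submodule R (E × M) := LinearMap.ker (p.coprod (-f))
  have hP : ∀ x : E × M, x ∈ P ↔ p x.1 = f x.2 := fun x => by
    simp [P, ← sub_eq_add_neg, sub_eq_zero]
  let j : B →ₗ[R] P := (LinearMap.inl R E M ∘ₗ i).codRestrict P fun b => by
    simpa [hP] using (hip _).2 ⟨b, rfl⟩
  obtain ⟨s, hs⟩ := h.exists_section j (LinearMap.snd R E M ∘ₗ P.subtype)
    (fun a b hab => hi (congrArg (fun z : P => z.1.1) hab))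
    (fun y => by
      constructor
      · intro hy
        have h2 : y.1.2 = 0 := hy
        obtain ⟨b, hb⟩ := (hip y.1.1).1 (by rw [(hP _).1 y.2, h2, map_zero])
        exact ⟨b, Subtype.ext (Prod.ext hb h2.symm)⟩
      · rintro ⟨b, rfl⟩
        rfl)
    (fun m => by
      obtain ⟨e, he⟩ := hp (f m)
      exact ⟨⟨(e, m), (hP _).2 he⟩, rfl⟩)
  refine ⟨LinearMap.fst R E M ∘ₗ P.subtype ∘ₗ s, fun x => ?_⟩
  have h1 := (hP _).1 (s x).2
  have h2 : (s x).1.2 = x := hs x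
  rw [h2] at h1
  exact h1

theorem Ext1Zero.exists_extension {K : Submodule R E}
    (h : Ext1Zero (ModuleCat.of R (E ⧸ K)) (ModuleCat.of R B)) (f : K →ₗ[R] B) :
    ∃ s : E →ₗ[R] B, ∀ x : K, s x = f x := by
  let N : Submodule R (B × E) := LinearMap.range (f.prod (-K.subtype))
  have hN : ∀ b e, (b, e) ∈ N ↔ ∃ k : K, f k = b ∧ -(k : E) = e := fun b e => by
    simp [N, Prod.ext_iff]
  let i : B →ₗ[R] ((B × E) ⧸ N) := N.mkQ ∘ₗ LinearMap.inl R B E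
  let p : ((B × E) ⧸ N) →ₗ[R] (E ⧸ K) := N.liftQ (K.mkQ ∘ₗ LinearMap.snd R B E) (by
    rintro ⟨b, e⟩ hbe
    obtain ⟨k, -, rfl⟩ := (hN _ _).1 hbe
    simp)
  have hi : Function.Injective i := by
    rw [injective_iff_map_eq_zero]
    intro b hb
    obtain ⟨k, rfl, hk⟩ := (hN b 0).1 ((Submodule.Quotient.mk_eq_zero N).1 hb)
    have : k = 0 := Subtype.ext (neg_eq_zero.1 hk)
    rw [this, map_zero]
  have hip : Function.Exact i p := by
    intro y
    constructor
    · intro hy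
      obtain ⟨⟨b, e⟩, rfl⟩ := N.mkQ_surjective y
      have he : e ∈ K := (Submodule.Quotient.mk_eq_zero K).1 hy
      refine ⟨b + f ⟨e, he⟩, ?_⟩
      refine (Submodule.Quotient.eq N).2 ((hN _ _).2 ⟨⟨e, he⟩, ?_, ?_⟩) <;> simp
    · rintro ⟨b, rfl⟩
      simp [i, p]
  obtain ⟨s, hs⟩ := h.exists_section i p hi hip (fun y => by
    obtain ⟨e, rfl⟩ := K.mkQ_surjective y
    exact ⟨N.mkQ (0, e), by simp [p]⟩)
  have hr : ∀ x : E, (N.mkQ ∘ₗ LinearMap.inr R B E - s ∘ₗ K.mkQ) x ∈ LinearMap.range i := by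
    intro x
    refine (hip _).1 ?_
    rw [LinearMap.sub_apply, map_sub, LinearMap.comp_apply s, hs]
    simp [p]
  let e := LinearEquiv.ofInjective i hi
  refine ⟨e.symm.toLinearMap ∘ₗ LinearMap.codRestrict _ _ hr, fun x => ?_⟩
  refine (LinearEquiv.symm_apply_eq e).2 (Subtype.ext ?_)
  change N.mkQ (0, (x : E)) - s (K.mkQ (x : E)) = N.mkQ (f x, 0)
  rw [(Submodule.Quotient.mk_eq_zero K).2 x.2 |> fun h => (show K.mkQ (x : E) = 0 from h), map_zero,
    sub_zero]
  refine (Submodule.Quotient.eq N).2 ((hN _ _).2 ⟨-x, ?_, ?_⟩) <;> simp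

theorem ext1Zero_of_exists_extension {K : Submodule R E} [Module.Projective R E]
    {Y : ModuleCat.{u} R}
    (hY : ∀ f : K →ₗ[R] Y, ∃ s : E →ₗ[R] Y, ∀ x : K, s x = f x)
    {X : ModuleCat.{u} R} (π : E →ₗ[R] X) (hπ : Function.Surjective π) (hK : LinearMap.ker π = K) :
    Ext1Zero X Y := by
  intro W i p w hw
  have hi : Function.Injective i.hom := (ModuleCat.mono_iff_injective _).1 hw.mono_f
  have hp : Function.Surjective p.hom := (ModuleCat.epi_iff_surjective _).1 hw.epi_g
  have hip : Function.Exact i.hom p.hom :=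
    (ShortComplex.ShortExact.moduleCat_exact_iff_function_exact _).1 hw.exact
  obtain ⟨l, hl⟩ := Module.projective_lifting_property p.hom π hp
  have hl' : ∀ x, p.hom (l x) = π x := fun x => LinearMap.congr_fun hl x
  have hr : ∀ x : K, (l ∘ₗ K.subtype) x ∈ LinearMap.range i.hom := fun x => by
    refine (hip _).1 ?_
    rw [LinearMap.comp_apply, hl']
    exact LinearMap.mem_ker.1 (hK ▸ x.2)
  let e := LinearEquiv.ofInjective i.hom hi
  obtain ⟨s, hs⟩ := hY (e.symm.toLinearMap ∘ₗ LinearMap.codRestrict _ _ hr)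
  have hk : LinearMap.ker π ≤ LinearMap.ker (l - i.hom ∘ₗ s) := fun x hx => by
    have hx' : x ∈ K := hK ▸ hx
    have h1 : s x = e.symm ⟨l x, hr ⟨x, hx'⟩⟩ := hs ⟨x, hx'⟩
    have h2 := congrArg Subtype.val (e.apply_symm_apply ⟨l x, hr ⟨x, hx'⟩⟩)
    rw [LinearMap.mem_ker, LinearMap.sub_apply, LinearMap.comp_apply, h1, sub_eq_zero]
    exact h2.symm
  let q := LinearMap.quotKerEquivOfSurjective π hπ
  obtain ⟨t, ht⟩ : ∃ t : X →ₗ[R] W, ∀ y, t (π y) = l y - i.hom (s y) := by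
    refine ⟨(LinearMap.ker π).liftQ _ hk ∘ₗ q.symm.toLinearMap, fun y => ?_⟩
    have hq : q.symm (π y) = (LinearMap.ker π).mkQ y := (LinearEquiv.symm_apply_eq q).2 rfl
    rw [LinearMap.comp_apply, LinearEquiv.coe_coe, hq]
    rfl
  refine ⟨ModuleCat.ofHom t, ?_⟩
  ext x
  obtain ⟨y, rfl⟩ := hπ x
  have hz : p.hom (i.hom (s y)) = 0 := (hip _).2 ⟨_, rfl⟩
  change p.hom (t (π y)) = π y
  rw [ht, map_sub, hl', hz, sub_zero]

end ExtOne

variable {S : Set (ModuleCat.{u} R)}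

section RelIn

variable {M : Type u} [AddCommGroup M] [Module R M]

/-- `L ≤ L'` and the subquotient `L' / L` belongs to `S`. -/
def RelIn (S : Set (ModuleCat.{u} R)) (L L' : Submodule R M) : Prop :=
  L ≤ L' ∧ ModuleCat.of R (L' ⧸ L.submoduleOf L') ∈ S

theorem relIn_iff (hS : Admissible S) {E : Type u} [AddCommGroup E] [Module R E]
    {L L' : Submodule R M} (a : E →ₗ[R] M) (h : L' = L ⊔ LinearMap.range a) :
    RelIn S L L' ↔ ModuleCat.of R (E ⧸ L.comap a) ∈ S := by
  have ha : ∀ x, a x ∈ L' := fun x => h ▸ Submodule.mem_sup_right ⟨x, rfl⟩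
  let b : E →ₗ[R] L' ⧸ L.submoduleOf L' := (L.submoduleOf L').mkQ ∘ₗ a.codRestrict L' ha
  have hb : Function.Surjective b := by
    intro y
    obtain ⟨⟨y, hy⟩, rfl⟩ := Submodule.mkQ_surjective _ y
    rw [h] at hy
    obtain ⟨l, hl, -, ⟨x, rfl⟩, rfl⟩ := Submodule.mem_sup.1 hy
    refine ⟨x, (Submodule.Quotient.eq _).2 ?_⟩
    simpa [Submodule.submoduleOf] using hl
  have hk : LinearMap.ker b = L.comap a := by
    ext x
    exact Submodule.Quotient.mk_eq_zero _
  let e := (Submodule.quotEquivOfEq _ _ hk).symm ≪≫ₗ LinearMap.quotKerEquivOfSurjective b hb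
  exact ⟨fun h1 => hS.of_linearEquiv e.symm h1.2,
    fun h1 => ⟨h ▸ le_sup_left, hS.of_linearEquiv e h1⟩⟩

theorem RelIn.refl (hS : Admissible S) (L : Submodule R M) : RelIn S L L :=
  (relIn_iff hS (0 : PUnit.{u + 1} →ₗ[R] M) (by simp)).2 (hS.zero _)

theorem RelIn.trans (hS : Admissible S) {L L' L'' : Submodule R M} (h : RelIn S L L')
    (h' : RelIn S L' L'') : RelIn S L L'' := by
  refine ⟨h.1.trans h'.1, ?_⟩
  refine hS.ext ((L.submoduleOf L').mapQ (L.submoduleOf L'') (Submodule.inclusion h'.1)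
    fun x hx => hx) ((L.submoduleOf L'').mapQ (L'.submoduleOf L'') LinearMap.id
    fun x hx => h.1 hx) ?_ ?_ ?_ h.2 h'.2
  · rw [injective_iff_map_eq_zero]
    intro x hx
    obtain ⟨x, rfl⟩ := Submodule.mkQ_surjective _ x
    have hx' : (x : M) ∈ L := (Submodule.Quotient.mk_eq_zero (L.submoduleOf L'')).1 hx
    exact (Submodule.Quotient.mk_eq_zero _).2 hx'
  · intro x
    obtain ⟨x, rfl⟩ := Submodule.mkQ_surjective _ x
    constructor
    · intro hx
      have hx' : (x : M) ∈ L' := (Submodule.Quotient.mk_eq_zero (L'.submoduleOf L'')).1 hx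
      exact ⟨(L.submoduleOf L').mkQ ⟨x, hx'⟩, rfl⟩
    · rintro ⟨y, hy⟩
      obtain ⟨y, rfl⟩ := Submodule.mkQ_surjective _ y
      rw [← hy]
      exact (Submodule.Quotient.mk_eq_zero _).2 y.2
  · intro x
    obtain ⟨x, rfl⟩ := Submodule.mkQ_surjective _ x
    exact ⟨(L.submoduleOf L'').mkQ x, rfl⟩

theorem exists_fg_le_sup {A B U : Submodule R M} (hU : U.FG) (h : U ≤ A ⊔ B) :
    ∃ N : Submodule R M, N.FG ∧ N ≤ B ∧ U ≤ A ⊔ N := by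
  induction U, hU using Submodule.fg_induction with
  | singleton x =>
    obtain ⟨a, ha, b, hb, hx⟩ := Submodule.mem_sup.1 (h (Submodule.mem_span_singleton_self x))
    refine ⟨Submodule.span R {b}, Submodule.fg_span_singleton b,
      (Submodule.span_singleton_le_iff_mem _ _).2 hb,
      (Submodule.span_singleton_le_iff_mem _ _).2 ?_⟩
    rw [← hx]
    exact add_mem (Submodule.mem_sup_left ha)
      (Submodule.mem_sup_right (Submodule.mem_span_singleton_self b))
  | sup U₁ U₂ _ _ h₁ h₂ =>
    obtain ⟨N₁, f₁, l₁, u₁⟩ := h₁ (le_sup_left.trans h)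
    obtain ⟨N₂, f₂, l₂, u₂⟩ := h₂ (le_sup_right.trans h)
    exact ⟨N₁ ⊔ N₂, f₁.sup f₂, sup_le l₁ l₂, sup_le (u₁.trans (sup_le_sup_left le_sup_left _))
      (u₂.trans (sup_le_sup_left le_sup_right _))⟩

theorem exists_fg_map_eq {N : Type u} [AddCommGroup N] [Module R N] (f : M →ₗ[R] N)
    (hf : Function.Surjective f) {W : Submodule R N} (hW : W.FG) :
    ∃ V : Submodule R M, V.FG ∧ V.map f = W := by
  induction W, hW using Submodule.fg_induction with
  | singleton x =>
    obtain ⟨y, rfl⟩ := hf x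
    exact ⟨Submodule.span R {y}, Submodule.fg_span_singleton y, by simp [Submodule.map_span]⟩
  | sup W₁ W₂ _ _ h₁ h₂ =>
    obtain ⟨V₁, f₁, rfl⟩ := h₁
    obtain ⟨V₂, f₂, rfl⟩ := h₂
    exact ⟨V₁ ⊔ V₂, f₁.sup f₂, Submodule.map_sup _ _ _⟩

theorem RelIn.exists_fg (hS : Admissible S) {L L' : Submodule R M} (h : RelIn S L L') :
    ∃ V : Submodule R M, V.FG ∧ L' = L ⊔ V := by
  have := hS.fp _ h.2
  obtain ⟨V, hV, hVt⟩ := exists_fg_map_eq (L.submoduleOf L').mkQ (Submodule.mkQ_surjective _)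
    (Module.Finite.fg_top (R := R) (M := L' ⧸ L.submoduleOf L'))
  refine ⟨V.map L'.subtype, hV.map _, le_antisymm (fun x hx => ?_) (sup_le h.1 ?_)⟩
  · obtain ⟨v, hv, hvx⟩ : (L.submoduleOf L').mkQ ⟨x, hx⟩ ∈ V.map (L.submoduleOf L').mkQ :=
      hVt ▸ Submodule.mem_top
    have h1 : x - v ∈ L := (Submodule.Quotient.eq (L.submoduleOf L')).1 hvx.symm
    rw [← sub_add_cancel x v]
    exact add_mem (Submodule.mem_sup_left h1) (Submodule.mem_sup_right ⟨v, hv, rfl⟩)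
  · rintro - ⟨v, -, rfl⟩
    exact v.2

end RelIn

/-- A family of submodules of `M` that is closed under unions of chains and in which every member
can be enlarged, by a subquotient from `S`, to a member containing a given element. -/
structure IsHill (S : Set (ModuleCat.{u} R)) {M : Type u} [AddCommGroup M] [Module R M]
    (H : Set (Submodule R M)) : Prop where
  bot_mem : ⊥ ∈ H
  sSup_mem : ∀ c ⊆ H, c.Nonempty → IsChain (· ≤ ·) c → sSup c ∈ H
  exists_rel : ∀ L ∈ H, ∀ x : M, ∃ L₁ ∈ H, x ∈ L₁ ∧ RelIn S L L₁

/-- The module `M` admits a Hill family of submodules. -/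
def HasHill (S : Set (ModuleCat.{u} R)) (M : Type u) [AddCommGroup M] [Module R M] : Prop :=
  ∃ H : Set (Submodule R M), IsHill S H

section IsHill

variable {M : Type u} [AddCommGroup M] [Module R M]

theorem IsHill.exists_rel_of_fg (hS : Admissible S) {H : Set (Submodule R M)} (hH : IsHill S H)
    {V : Submodule R M} (hV : V.FG) : ∀ L ∈ H, ∃ L' ∈ H, V ≤ L' ∧ RelIn S L L' := by
  induction V, hV using Submodule.fg_induction with
  | singleton x =>
    intro L hL
    simpa using hH.exists_rel L hL x
  | sup V₁ V₂ _ _ h₁ h₂ =>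
    intro L hL
    obtain ⟨L', hL', hV₁, r₁⟩ := h₁ L hL
    obtain ⟨L'', hL'', hV₂, r₂⟩ := h₂ L' hL'
    exact ⟨L'', hL'', sup_le (hV₁.trans r₂.1) hV₂, r₁.trans hS r₂⟩

theorem hasHill_directSum (hS : Admissible S) {ι : Type u} (T : ι → Type u)
    [∀ i, AddCommGroup (T i)] [∀ i, Module R (T i)] (hT : ∀ i, ModuleCat.of R (T i) ∈ S) :
    HasHill S (DirectSum ι T) := by
  classical
  let r : ι → Submodule R (DirectSum ι T) := fun i => LinearMap.range (DirectSum.lof R ι T i)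
  refine ⟨{L | L ≤ ⨆ (i) (_ : r i ≤ L), r i}, bot_le (α := Submodule R (DirectSum ι T)),
    fun c hc _ _ => ?_, fun L hL x => ?_⟩
  · refine sSup_le fun L hL => (hc hL).trans (iSup_mono fun i => ?_)
    exact iSup_mono' fun h => ⟨h.trans (le_sSup hL), le_rfl⟩
  · induction x using DirectSum.induction_on generalizing L with
    | zero => exact ⟨L, hL, zero_mem L, RelIn.refl hS L⟩
    | of i t =>
      by_cases hi : r i ≤ L
      · exact ⟨L, hL, hi ⟨t, rfl⟩, RelIn.refl hS L⟩
      · refine ⟨L ⊔ r i, sup_le (α := Submodule R (DirectSum ι T))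
          (hL.trans (iSup_mono fun j => ?_)) ?_,
          Submodule.mem_sup_right ⟨t, rfl⟩, (relIn_iff hS (DirectSum.lof R ι T i) rfl).2 ?_⟩
        · exact iSup_mono' fun h => ⟨h.trans le_sup_left, le_rfl⟩
        · exact le_iSup₂_of_le i le_sup_right le_rfl
        · have h0 : L ≤ LinearMap.ker (DirectSum.component R ι T i) := by
            refine hL.trans (iSup₂_le fun j hj => ?_)
            rintro - ⟨y, rfl⟩
            have hij : j ≠ i := by
              rintro rfl
              exact hi hj
            exact DirectSum.of_eq_of_ne _ _ _ hij.symm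
          have h1 : L.comap (DirectSum.lof R ι T i) = ⊥ := by
            refine (Submodule.eq_bot_iff _).2 fun y hy => ?_
            have := h0 hy
            rwa [LinearMap.mem_ker, DirectSum.component.lof_self] at this
          rw [h1]
          exact hS.of_linearEquiv (Submodule.quotEquivOfEqBot ⊥ rfl).symm (hT i)
    | add x y hx hy =>
      obtain ⟨L', hL', m₁, r₁⟩ := hx L hL
      obtain ⟨L'', hL'', m₂, r₂⟩ := hy L' hL'
      exact ⟨L'', hL'', add_mem (r₂.1 m₁) m₂, r₁.trans hS r₂⟩

theorem HasHill.of_linearEquiv (hS : Admissible S) {N : Type u} [AddCommGroup N] [Module R N]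
    (e : M ≃ₗ[R] N) (h : HasHill S M) : HasHill S N := by
  obtain ⟨H, hH⟩ := h
  have hbij : ∀ L : Submodule R N, (L.comap e.toLinearMap).map e.toLinearMap = L := fun L =>
    Submodule.map_comap_eq_of_surjective e.surjective L
  refine ⟨{L | L.comap e.toLinearMap ∈ H}, ?_, fun c hc hne hch => ?_, fun L hL x => ?_⟩
  · simpa [LinearMap.ker_eq_bot.2 e.injective] using hH.bot_mem
  · have : (sSup c).comap e.toLinearMap = sSup ((fun L => L.comap e.toLinearMap) '' c) := by
      refine le_antisymm ?_ (sSup_le ?_)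
      · rw [← Submodule.map_le_map_iff_of_injective (f := e.toLinearMap) e.injective, hbij]
        refine sSup_le fun L hL => ?_
        rw [← hbij L]
        exact Submodule.map_mono (le_sSup ⟨L, hL, rfl⟩)
      · rintro - ⟨L, hL, rfl⟩
        exact Submodule.comap_mono (le_sSup hL)
    rw [Set.mem_ofPred_eq, this]
    refine hH.sSup_mem _ ?_ (hne.image _) ?_
    · rintro - ⟨L, hL, rfl⟩
      exact hc hL
    · rintro - ⟨L, hL, rfl⟩ - ⟨L', hL', rfl⟩ -
      exact (hch.total hL hL').imp (fun h => Submodule.comap_mono h)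
        fun h => Submodule.comap_mono h
  · obtain ⟨L', hL', hx, r⟩ := hH.exists_rel _ hL (e.symm x)
    refine ⟨L'.map e.toLinearMap, ?_, ⟨_, hx, by simp⟩, ?_⟩
    · rwa [Set.mem_ofPred_eq, Submodule.comap_map_eq_of_injective e.injective]
    · refine (relIn_iff hS (e.toLinearMap ∘ₗ L'.subtype) ?_).2 r.2
      rw [LinearMap.range_comp, Submodule.range_subtype, right_eq_sup, ← hbij L]
      exact Submodule.map_mono r.1

theorem HasHill.prod (hS : Admissible S) {N : Type u} [AddCommGroup N] [Module R N]
    (hM : HasHill S M) (hN : HasHill S N) : HasHill S (M × N) := by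
  obtain ⟨H₁, h₁⟩ := hM
  obtain ⟨H₂, h₂⟩ := hN
  have add : ∀ L₁ ∈ H₁, ∀ L₂ ∈ H₂, ∀ x : M × N, ∃ L₁' ∈ H₁, ∃ L₂' ∈ H₂, x ∈ L₁'.prod L₂' ∧
      RelIn S (L₁.prod L₂) (L₁'.prod L₂') := by
    intro L₁ m₁ L₂ m₂ x
    obtain ⟨L₁', m₁', x₁, r₁⟩ := h₁.exists_rel L₁ m₁ x.1
    obtain ⟨L₂', m₂', x₂, r₂⟩ := h₂.exists_rel L₂ m₂ x.2
    refine ⟨L₁', m₁', L₂', m₂', ⟨x₁, x₂⟩, RelIn.trans hS (L' := L₁'.prod L₂) ?_ ?_⟩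
    · refine (relIn_iff hS (LinearMap.inl R M N ∘ₗ L₁'.subtype) ?_).2 ?_
      · rw [LinearMap.range_comp, Submodule.range_subtype, Submodule.map_inl,
          Submodule.prod_sup_prod,
          sup_bot_eq, sup_eq_right.2 r₁.1]
      · rw [Submodule.comap_comp, Submodule.prod_comap_inl]
        exact r₁.2
    · refine (relIn_iff hS (LinearMap.inr R M N ∘ₗ L₂'.subtype) ?_).2 ?_
      · rw [LinearMap.range_comp, Submodule.range_subtype, Submodule.map_inr,
          Submodule.prod_sup_prod,
          sup_bot_eq, sup_eq_right.2 r₂.1]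
      · rw [Submodule.comap_comp, Submodule.prod_comap_inr]
        exact r₂.2
  refine ⟨{L | L.map (LinearMap.fst R M N) ∈ H₁ ∧ L.map (LinearMap.snd R M N) ∈ H₂ ∧
    (L.map (LinearMap.fst R M N)).prod (L.map (LinearMap.snd R M N)) ≤ L}, ?_, ?_, ?_⟩
  · simp only [Set.mem_ofPred_eq, Submodule.map_bot]
    exact ⟨h₁.bot_mem, h₂.bot_mem, by simp⟩
  · intro c hc hne hch
    have hmap : ∀ {P : Type u} [AddCommGroup P] [Module R P] (f : M × N →ₗ[R] P)
        (H : Set (Submodule R P)), IsHill S H → (∀ L ∈ c, L.map f ∈ H) → (sSup c).map f ∈ H := by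
      intro P _ _ f H hH hcH
      rw [sSup_eq_iSup', Submodule.map_iSup, ← sSup_range]
      refine hH.sSup_mem _ ?_ ?_ ?_
      · rintro - ⟨L, rfl⟩
        exact hcH L L.2
      · have := hne.to_subtype
        exact Set.range_nonempty _
      · rintro - ⟨L, rfl⟩ - ⟨L', rfl⟩ -
        rcases hch.total L.2 L'.2 with h | h
        · exact Or.inl (Submodule.map_mono h)
        · exact Or.inr (Submodule.map_mono h)
    refine ⟨hmap _ H₁ h₁ fun L hL => (hc hL).1, hmap _ H₂ h₂ fun L hL => (hc hL).2.1, ?_⟩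
    have hd := hch.directedOn
    rintro ⟨x, y⟩ ⟨⟨p, hp, hpx⟩, q, hq, hqy⟩
    obtain ⟨L, hL, hpL⟩ := (Submodule.mem_sSup_of_directed hne hd).1 hp
    obtain ⟨L', hL', hqL⟩ := (Submodule.mem_sSup_of_directed hne hd).1 hq
    obtain ⟨L'', hL'', l, l'⟩ := hd L hL L' hL'
    exact le_sSup hL'' ((hc hL'').2.2 ⟨⟨p, l hpL, hpx⟩, q, l' hqL, hqy⟩)
  · rintro L ⟨m₁, m₂, hL⟩ x
    obtain ⟨L₁', m₁', L₂', m₂', hx, r⟩ := add _ m₁ _ m₂ x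
    have hL' : (L.map (LinearMap.fst R M N)).prod (L.map (LinearMap.snd R M N)) = L :=
      le_antisymm hL fun y hy => ⟨⟨y, hy, rfl⟩, y, hy, rfl⟩
    rw [hL'] at r
    refine ⟨_, ?_, hx, r⟩
    rw [Set.mem_ofPred_eq, Submodule.prod_map_fst, Submodule.prod_map_snd]
    exact ⟨m₁', m₂', le_rfl⟩

end IsHill

section Chain

variable {M : Type u} [AddCommGroup M] [Module R M] {F Q : ℕ → Type u}
  [∀ k, AddCommGroup (F k)] [∀ k, Module R (F k)] [∀ k, AddCommGroup (Q k)] [∀ k, Module R (Q k)]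

theorem mem_map_comap_of_le_sup {E F G : Type u} [AddCommGroup E] [Module R E] [AddCommGroup F]
    [Module R F] [AddCommGroup G] [Module R G] {a : E →ₗ[R] M} {b : F →ₗ[R] M} {π : F →ₗ[R] G}
    (hab : LinearMap.range a ≤ LinearMap.range b) (hπ : ∀ x, π x = 0 ↔ b x ∈ LinearMap.range a)
    {L : Submodule R M} {x : F} (hx : b x ∈ L ⊔ LinearMap.range a) :
    π x ∈ (L.comap b).map π := by
  obtain ⟨l, hl, y, hy, hly⟩ := Submodule.mem_sup.1 hx
  obtain ⟨z, rfl⟩ := hab hy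
  refine ⟨x - z, ?_, ?_⟩
  · rw [SetLike.mem_coe, Submodule.mem_comap, map_sub, ← hly, add_sub_cancel_right]
    exact hl
  · rw [map_sub, (hπ z).2 hy, sub_zero]

theorem mem_sup_of_mem_map_comap {E F G : Type u} [AddCommGroup E] [Module R E] [AddCommGroup F]
    [Module R F] [AddCommGroup G] [Module R G] {a : E →ₗ[R] M} {b : F →ₗ[R] M} {π : F →ₗ[R] G}
    (hπ : ∀ x, π x = 0 ↔ b x ∈ LinearMap.range a) {L : Submodule R M} {x : F}
    (hx : π x ∈ (L.comap b).map π) : b x ∈ L ⊔ LinearMap.range a := by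
  obtain ⟨z, hz, hzx⟩ := hx
  have h : b (x - z) ∈ LinearMap.range a := (hπ _).1 (by rw [map_sub, hzx, sub_self])
  rw [← add_sub_cancel z x, map_add]
  exact add_mem (Submodule.mem_sup_left hz) (Submodule.mem_sup_right h)

theorem HasHill.of_chain (hS : Admissible S) (c : ∀ k, F k →ₗ[R] M)
    (hc : ∀ k, LinearMap.range (c k) ≤ LinearMap.range (c (k + 1)))
    (hc₀ : LinearMap.range (c 0) = ⊥) (hM : ∀ m, ∃ k, m ∈ LinearMap.range (c k))
    (π : ∀ k, F (k + 1) →ₗ[R] Q k) (hπs : ∀ k, Function.Surjective (π k))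
    (hπ : ∀ k x, π k x = 0 ↔ c (k + 1) x ∈ LinearMap.range (c k)) (hQ : ∀ k, HasHill S (Q k)) :
    HasHill S M := by
  choose H hH using hQ
  have hmono : Monotone fun k => LinearMap.range (c k) := monotone_nat_of_le_succ hc
  let D : ∀ k, Submodule R M → Submodule R (Q k) := fun k L => (L.comap (c (k + 1))).map (π k)
  have hD : ∀ k, Monotone (D k) := fun k L L' h => Submodule.map_mono (Submodule.comap_mono h)
  have hDmem : ∀ {k L x}, π k x ∈ D k L ↔ c (k + 1) x ∈ L ⊔ LinearMap.range (c k) := fun {k L x} =>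
    ⟨mem_sup_of_mem_map_comap (hπ k), mem_map_comap_of_le_sup (hc k) (hπ k)⟩
  have hDle : ∀ {k L D'}, (∀ x, c (k + 1) x ∈ L → π k x ∈ D') → D k L ≤ D' := by
    rintro k L D' h - ⟨x, hx, rfl⟩
    exact h x hx
  have hDeq : ∀ {k L L'}, L ≤ L' → L' ≤ L ⊔ LinearMap.range (c k) → D k L' = D k L :=
    fun h h' => le_antisymm (hDle fun x hx => hDmem.2 (h' hx)) (hD _ h)
  have step : ∀ k (L : Submodule R M), (∀ j, D j L ∈ H j) → ∀ V : Submodule R M, V.FG →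
      V ≤ LinearMap.range (c k) → ∃ L' : Submodule R M, (∀ j, D j L' ∈ H j) ∧ V ≤ L' ∧
        L' ≤ L ⊔ LinearMap.range (c k) ∧ RelIn S L L' := by
    intro k
    induction k with
    | zero =>
      intro L hL V _ hV
      exact ⟨L, hL, (hV.trans hc₀.le).trans bot_le, le_sup_left, RelIn.refl hS L⟩
    | succ k ih =>
      intro L hL V hVfg hV
      obtain ⟨V₀, hV₀, rfl⟩ : ∃ V₀ : Submodule R (F (k + 1)), V₀.FG ∧ V₀.map (c (k + 1)) = V := by
        obtain ⟨V', hV', hVV'⟩ := exists_fg_map_eq (c (k + 1)).rangeRestrict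
          (c (k + 1)).surjective_rangeRestrict (Submodule.fg_of_fg_map_injective
            (N := V.comap (LinearMap.range (c (k + 1))).subtype) _ Subtype.val_injective
            (by rwa [Submodule.map_comap_subtype, inf_eq_right.2 hV]))
        refine ⟨V', hV', ?_⟩
        have := congrArg (Submodule.map (LinearMap.range (c (k + 1))).subtype) hVV'
        rwa [← Submodule.map_comp, Submodule.map_comap_subtype, inf_eq_right.2 hV] at this
      obtain ⟨D', hD', hVD, r⟩ := (hH k).exists_rel_of_fg hS (hV₀.map (π k)) _ (hL k)
      obtain ⟨W, hW, hDW⟩ := r.exists_fg hS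
      obtain ⟨W₀, hW₀, rfl⟩ := exists_fg_map_eq (π k) (hπs k) hW
      let Q₀ := V₀ ⊔ W₀
      have hQ₀ : Q₀.FG := hV₀.sup hW₀
      let a := π k ∘ₗ Q₀.subtype
      let b := c (k + 1) ∘ₗ Q₀.subtype
      have hD'Q : D' = D k L ⊔ LinearMap.range a := by
        rw [LinearMap.range_comp, Submodule.range_subtype, Submodule.map_sup]
        refine le_antisymm ?_ (sup_le r.1 (sup_le hVD (hDW ▸ le_sup_right)))
        rw [hDW]
        exact sup_le_sup_left le_sup_right _
      have hK : ModuleCat.of R (Q₀ ⧸ (D k L).comap a) ∈ S := (relIn_iff hS a hD'Q).1 r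
      have hKfg : ((D k L).comap a).FG := by
        have := Module.Finite.of_fg hQ₀
        have := hS.fp _ hK
        have := Module.FinitePresentation.fg_ker ((D k L).comap a).mkQ (Submodule.mkQ_surjective _)
        rwa [Submodule.ker_mkQ] at this
      obtain ⟨N, hN, hNk, hKN⟩ := exists_fg_le_sup (A := L) (B := LinearMap.range (c k))
        (hKfg.map b) (by
          rintro - ⟨x, hx, rfl⟩
          exact hDmem.1 hx)
      obtain ⟨L'', hL'', hNL, hLk, r'⟩ := ih L hL N hN hNk
      have hb : ∀ q : Q₀, b q ∈ L'' ⊔ LinearMap.range (c k) → b q ∈ L'' := fun q hq =>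
        (hKN.trans (sup_le r'.1 hNL)) ⟨q, hDmem.2 ((sup_le hLk le_sup_right) hq), rfl⟩
      have hbc : L''.comap b = (D k L).comap a := by
        ext q
        exact ⟨fun hq => hDmem.2 (hLk hq),
          fun hq => hb q ((sup_le_sup_right r'.1 _) (hDmem.1 hq))⟩
      have hbr : LinearMap.range b ≤ LinearMap.range (c (k + 1)) :=
        LinearMap.range_comp_le_range _ _
      have hr : RelIn S L'' (L'' ⊔ LinearMap.range b) := (relIn_iff hS b rfl).2 (hbc ▸ hK)
      have hLk' : L'' ⊔ LinearMap.range b ≤ L ⊔ LinearMap.range (c (k + 1)) :=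
        sup_le (hLk.trans (sup_le_sup_left (hc k) _)) (hbr.trans le_sup_right)
      refine ⟨L'' ⊔ LinearMap.range b, fun j => ?_, ?_, hLk', r'.trans hS hr⟩
      · rcases lt_trichotomy j k with hj | rfl | hj
        · refine (le_antisymm (hDle fun x hx => ?_) (hD j le_sup_left) : D j _ = D j L'') ▸ hL'' j
          obtain ⟨l, hl, -, ⟨q, rfl⟩, hlq⟩ := Submodule.mem_sup.1 hx
          have hq : b q ∈ L'' := hb q (by
            rw [← sub_eq_of_eq_add' hlq.symm, sub_eq_neg_add]
            exact add_mem (Submodule.mem_sup_left (neg_mem hl))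
              (Submodule.mem_sup_right (hmono hj ⟨x, rfl⟩)))
          have hxL : c (j + 1) x ∈ L'' := hlq ▸ add_mem hl hq
          exact ⟨x, hxL, rfl⟩
        · refine (le_antisymm (hDle fun x hx => ?_) ?_ : D j _ = D') ▸ hD'
          · obtain ⟨l, hl, -, ⟨q, rfl⟩, hlq⟩ := Submodule.mem_sup.1 hx
            have h1 : c (j + 1) (x - q) ∈ L'' := by
              rw [map_sub, ← hlq]
              simpa [b] using hl
            rw [hD'Q, ← sub_add_cancel x q, map_add]
            exact add_mem (Submodule.mem_sup_left (hDmem.2 (hLk h1)))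
              (Submodule.mem_sup_right ⟨q, rfl⟩)
          · rw [hD'Q]
            refine sup_le (hD j (r'.1.trans le_sup_left)) ?_
            rintro - ⟨q, rfl⟩
            exact ⟨q, Submodule.mem_sup_right ⟨q, rfl⟩, rfl⟩
        · exact hDeq (r'.1.trans le_sup_left) (hLk'.trans (sup_le_sup_left (hmono hj) _)) ▸ hL j
      · rintro - ⟨v, hv, rfl⟩
        exact Submodule.mem_sup_right ⟨⟨v, Submodule.mem_sup_left hv⟩, rfl⟩
  refine ⟨{L | ∀ k, D k L ∈ H k}, fun k => ?_, fun C hC hne hch k => ?_, fun L hL x => ?_⟩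
  · have : D k ⊥ = ⊥ := (Submodule.eq_bot_iff _).2 (by
      rintro - ⟨x, hx, rfl⟩
      exact (hπ k x).2 ((Submodule.mem_bot R).1 hx ▸ zero_mem _))
    exact this ▸ (hH k).bot_mem
  · have : D k (sSup C) = sSup (D k '' C) := by
      refine le_antisymm (hDle fun x hx => ?_) (sSup_le ?_)
      · obtain ⟨L, hL, hx⟩ := (Submodule.mem_sSup_of_directed hne hch.directedOn).1 hx
        exact (le_sSup ⟨L, hL, rfl⟩ : D k L ≤ sSup (D k '' C)) ⟨x, hx, rfl⟩
      · rintro - ⟨L, hL, rfl⟩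
        exact hD k (le_sSup hL)
    rw [this]
    refine (hH k).sSup_mem _ ?_ (hne.image _) ?_
    · rintro - ⟨L, hL, rfl⟩
      exact hC hL k
    · rintro - ⟨L, hL, rfl⟩ - ⟨L', hL', rfl⟩ -
      exact (hch.total hL hL').imp (fun h => hD k h) fun h => hD k h
  · obtain ⟨k, hk⟩ := hM x
    obtain ⟨L', hL', hx, -, r⟩ := step k L hL (Submodule.span R {x}) (Submodule.fg_span_singleton x)
      ((Submodule.span_singleton_le_iff_mem _ _).2 hk)
    exact ⟨L', hL', (Submodule.span_singleton_le_iff_mem _ _).1 hx, r⟩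

theorem HasHill.finsupp (hS : Admissible S) (h : HasHill S M) : HasHill S (ℕ →₀ M) := by
  have hmem : ∀ k (x : ℕ →₀ M),
      x ∈ Finsupp.supported M R (Set.Iio k) ↔ ∀ i, k ≤ i → x i = 0 := fun k x => by
    simp [Finsupp.mem_supported']
  refine HasHill.of_chain hS (F := fun k => Finsupp.supported M R (Set.Iio k)) (Q := fun _ => M)
    (fun k => Submodule.subtype _) (fun k => ?_) ?_ (fun m => ?_)
    (fun k => Finsupp.lapply k ∘ₗ Submodule.subtype _) (fun k y => ?_) (fun k x => ?_) fun _ => h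
  · simp only [Submodule.range_subtype]
    exact fun x hx => (hmem _ _).2 fun i hi => (hmem _ _).1 hx i (Nat.le_of_succ_le hi)
  · rw [Submodule.range_subtype, Submodule.eq_bot_iff]
    intro x hx
    ext i
    exact (hmem _ _).1 hx i (Nat.zero_le i)
  · obtain ⟨k, hk⟩ := m.support.exists_nat_subset_range
    refine ⟨k, ?_⟩
    rw [Submodule.range_subtype, hmem]
    intro i hi
    by_contra hmi
    exact absurd (Finset.mem_range.1 (hk (Finsupp.mem_support_iff.2 hmi))) (not_lt.2 hi)
  · refine ⟨⟨Finsupp.single k y, (hmem _ _).2 fun i hi => ?_⟩, by simp⟩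
    exact Finsupp.single_eq_of_ne (by omega)
  · rw [Submodule.range_subtype, hmem]
    constructor
    · intro hx i hi
      rcases hi.eq_or_lt with rfl | hi
      · exact hx
      · exact (hmem _ _).1 x.2 i hi
    · exact fun hx => hx k le_rfl

end Chain

section CellAttachment

variable {A F : Type u} [AddCommGroup A] [Module R A] [AddCommGroup F] [Module R F]

/-- Attaching cells `K i ≤ E i` to a module along maps `K i → F`. -/
theorem exists_cell_attachment {ι : Type u} (p : F →ₗ[R] A) {E : ι → Type u}
    [∀ i, AddCommGroup (E i)] [∀ i, Module R (E i)] (K : ∀ i, Submodule R (E i))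
    (g : ∀ i, K i →ₗ[R] F) (h : ∀ i, E i →ₗ[R] A) (w : ∀ i k, p (g i k) = h i k) :
    ∃ (F' : ModuleCat.{u} R) (p' : F' →ₗ[R] A) (j : F →ₗ[R] F') (e : ∀ i, E i →ₗ[R] F')
      (π : F' →ₗ[R] DirectSum ι fun i => E i ⧸ K i), Function.Injective j ∧ (∀ x, p' (j x) = p x) ∧
      (∀ i (k : K i), e i k = j (g i k)) ∧ (∀ i x, p' (e i x) = h i x) ∧
      Function.Surjective π ∧ ∀ x, π x = 0 ↔ x ∈ LinearMap.range j := by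
  classical
  let I : DirectSum ι (fun i => K i) →ₗ[R] DirectSum ι E := DirectSum.lmap fun i => (K i).subtype
  have hI : Function.Injective I :=
    (DirectSum.lmap_injective _).2 fun i => Subtype.val_injective
  let q : DirectSum ι E →ₗ[R] DirectSum ι fun i => E i ⧸ K i := DirectSum.lmap fun i => (K i).mkQ
  have hq : Function.Surjective q :=
    (DirectSum.lmap_surjective _).2 fun i => (K i).mkQ_surjective
  let G : DirectSum ι (fun i => K i) →ₗ[R] F := DirectSum.toModule R ι F g
  let H : DirectSum ι E →ₗ[R] A := DirectSum.toModule R ι A h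
  have hGH : p ∘ₗ G = H ∘ₗ I := DirectSum.linearMap_ext R fun i => LinearMap.ext fun k => by
    simp [G, H, I, w]
  have hqI : q ∘ₗ I = 0 := DirectSum.linearMap_ext R fun i => LinearMap.ext fun k => by
    have : Submodule.Quotient.mk (p := K i) (k : E i) = 0 :=
      (Submodule.Quotient.mk_eq_zero _).2 k.2
    simp [q, I, this]
  have hker : ∀ y, q y = 0 → ∃ z, I z = y := by
    intro y hy
    rw [← LinearMap.mem_range, DirectSum.range_lmap]
    intro i _
    have : q y i = 0 := by rw [hy, DirectSum.zero_apply]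
    exact ⟨⟨y i, (Submodule.Quotient.mk_eq_zero _).1 this⟩, rfl⟩
  let N : Submodule R (F × DirectSum ι E) := LinearMap.range (G.prod (-I))
  have hN : ∀ a b, (a, b) ∈ N ↔ ∃ z, G z = a ∧ -I z = b := fun a b => by
    simp [N, Prod.ext_iff]
  refine ⟨ModuleCat.of R ((F × DirectSum ι E) ⧸ N), N.liftQ (p.coprod H) ?_,
    N.mkQ ∘ₗ LinearMap.inl R F _, fun i => N.mkQ ∘ₗ LinearMap.inr R F _ ∘ₗ DirectSum.lof R ι E i,
    N.liftQ (q ∘ₗ LinearMap.snd R F _) ?_, ?_, fun x => ?_, fun i k => ?_, fun i x => ?_,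
    fun y => ?_, fun x => ?_⟩
  · rintro - ⟨z, rfl⟩
    have := LinearMap.congr_fun hGH z
    simp only [LinearMap.comp_apply] at this
    simp [this]
  · rintro - ⟨z, rfl⟩
    have := LinearMap.congr_fun hqI z
    simp only [LinearMap.comp_apply] at this
    simp [this]
  · rw [injective_iff_map_eq_zero]
    intro a ha
    obtain ⟨z, rfl, hz⟩ := (hN a 0).1 ((Submodule.Quotient.mk_eq_zero N).1 ha)
    rw [(injective_iff_map_eq_zero I).1 hI z (neg_eq_zero.1 hz), map_zero]
  · simp
  · refine (Submodule.Quotient.eq N).2 ((hN _ _).2 ⟨-DirectSum.lof R ι (fun i => K i) i k, ?_, ?_⟩)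
      <;> simp [G, I]
  · simp [H]
  · obtain ⟨z, rfl⟩ := hq y
    exact ⟨N.mkQ (0, z), by simp⟩
  · constructor
    · intro hx
      obtain ⟨⟨a, y⟩, rfl⟩ := N.mkQ_surjective x
      obtain ⟨z, rfl⟩ := hker y hx
      refine ⟨a + G z, (Submodule.Quotient.eq N).2 ((hN _ _).2 ⟨z, ?_, ?_⟩)⟩ <;> simp
    · rintro ⟨a, rfl⟩
      simp

end CellAttachment

/-- The union of an increasing sequence of modules. -/
theorem exists_sequential_union {A : Type u} [AddCommGroup A] [Module R A]
    (F : ℕ → ModuleCat.{u} R) (p : ∀ k, F k →ₗ[R] A) (j : ∀ k, F k →ₗ[R] F (k + 1))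
    (hj : ∀ k, Function.Injective (j k)) (hp : ∀ k x, p (k + 1) (j k x) = p k x) :
    ∃ (M : ModuleCat.{u} R) (q : M →ₗ[R] A) (c : ∀ k, F k →ₗ[R] M),
      (∀ k, Function.Injective (c k)) ∧ (∀ k x, c (k + 1) (j k x) = c k x) ∧
      (∀ m, ∃ k, m ∈ LinearMap.range (c k)) ∧ ∀ k x, q (c k x) = p k x := by
  let G : ℕ ⥤ ModuleCat.{u} R := Functor.ofSequence fun k => ModuleCat.ofHom (j k)
  have hG : ∀ k, G.map (homOfLE k.le_succ) = ModuleCat.ofHom (j k) :=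
    Functor.ofSequence_map_homOfLE_succ _
  let t : Cocone G := ⟨ModuleCat.of R A, NatTrans.ofSequence (fun k => ModuleCat.ofHom (p k))
    fun k => by
      rw [hG]
      ext x
      exact hp k x⟩
  have hinj : ∀ {k l} (f : k ⟶ l), Function.Injective (G.map f) := by
    intro k l f
    obtain ⟨n, rfl⟩ := Nat.exists_eq_add_of_le (leOfHom f)
    induction n with
    | zero =>
      rw [show f = 𝟙 k from Subsingleton.elim _ _, G.map_id]
      exact Function.injective_id
    | succ n ih =>
      rw [show f = homOfLE (Nat.le_add_right k n) ≫ homOfLE (k + n).le_succ from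
        Subsingleton.elim _ _, G.map_comp, hG]
      exact (hj _).comp (ih _)
  have : PreservesFilteredColimitsOfSize.{0, 0} (forget (ModuleCat.{u} R)) :=
    preservesFilteredColimitsOfSize_shrink.{0, u, 0, u} _
  refine ⟨colimit G, (colimit.desc G t).hom, fun k => (colimit.ι G k).hom, fun k x y h => ?_,
    fun k x => ?_, fun m => ?_, fun k x => ?_⟩
  · obtain ⟨l, f, g, hfg⟩ := (Concrete.colimit_rep_eq_iff_exists G x y).1 h
    rw [Subsingleton.elim g f] at hfg
    exact hinj f hfg
  · have := colimit.w G (homOfLE k.le_succ)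
    rw [hG] at this
    exact congrArg (fun f => f.hom x) this
  · obtain ⟨k, y, hy⟩ := Concrete.colimit_exists_rep G m
    exact ⟨k, y, hy⟩
  · exact congrArg (fun f => f.hom x) (colimit.ι_desc t k)


section SmallObject

variable {A : Type u} [AddCommGroup A] [Module R A]

theorem exists_step (S : Set (ModuleCat.{u} R)) (X : Σ F : ModuleCat.{u} R, F →ₗ[R] A) :
    ∃ (Y : Σ F : ModuleCat.{u} R, F →ₗ[R] A) (j : X.1 →ₗ[R] Y.1), Function.Injective j ∧
      (∀ x, Y.2 (j x) = X.2 x) ∧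
      (∃ (ι : Type u) (T : ι → ModuleCat.{u} R) (π : Y.1 →ₗ[R] DirectSum ι fun i => T i),
        (∀ i, ModuleCat.of R (T i) ∈ S) ∧ Function.Surjective π ∧
        ∀ x, π x = 0 ↔ x ∈ LinearMap.range j) ∧
      ∀ (n : ℕ) (K : Submodule R (Fin n → R)), ModuleCat.of R ((Fin n → R) ⧸ K) ∈ S →
        ∀ (g : K →ₗ[R] X.1) (h : (Fin n → R) →ₗ[R] A), (∀ k, X.2 (g k) = h k) →
          ∃ e : (Fin n → R) →ₗ[R] Y.1, (∀ k : K, e k = j (g k)) ∧ ∀ x, Y.2 (e x) = h x := by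
  let ι : Type u := Σ (n : ℕ) (K : {K : Submodule R (Fin n → R) //
    ModuleCat.of R ((Fin n → R) ⧸ K) ∈ S}), {gh : (K.1 →ₗ[R] X.1) × ((Fin n → R) →ₗ[R] A) //
      ∀ k, X.2 (gh.1 k) = gh.2 k}
  obtain ⟨F', p', j, e, π, hj, hp, he, he', hπ, hπj⟩ := exists_cell_attachment (ι := ι) X.2
    (E := fun i => Fin i.1 → R) (fun i => i.2.1.1) (fun i => i.2.2.1.1) (fun i => i.2.2.1.2)
    fun i => i.2.2.2
  exact ⟨⟨F', p'⟩, j, hj, hp,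
    ⟨ι, fun i => ModuleCat.of R ((Fin i.1 → R) ⧸ i.2.1.1), π, fun i => i.2.1.2, hπ, hπj⟩,
    fun n K hK g h w => ⟨e ⟨n, ⟨K, hK⟩, ⟨(g, h), w⟩⟩, he ⟨n, ⟨K, hK⟩, ⟨(g, h), w⟩⟩,
      he' ⟨n, ⟨K, hK⟩, ⟨(g, h), w⟩⟩⟩⟩

theorem exists_hasHill_cover (hS : Admissible S) (A : Type u) [AddCommGroup A] [Module R A] :
    ∃ (F : ModuleCat.{u} R) (p : F →ₗ[R] A), HasHill S F ∧ Function.Surjective p ∧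
      ModuleCat.of R (LinearMap.ker p) ∈ rightPerp S := by
  choose Y j hj hp hπ hE using exists_step (A := A) S
  choose ι T π hT hπs hπ using hπ
  let X : ℕ → Σ F : ModuleCat.{u} R, F →ₗ[R] A := fun k =>
    Nat.rec ⟨ModuleCat.of R PUnit.{u + 1}, 0⟩ (fun _ => Y) k
  obtain ⟨M, q, c, hc, hcj, hcM, hq⟩ := exists_sequential_union (fun k => (X k).1)
    (fun k => (X k).2) (fun k => j (X k)) (fun k => hj (X k)) fun k => hp (X k)
  have hmono : Monotone fun k => LinearMap.range (c k) := monotone_nat_of_le_succ fun k => by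
    rintro - ⟨x, rfl⟩
    exact ⟨j (X k) x, hcj k x⟩
  have hill : HasHill S M := by
    refine HasHill.of_chain hS (F := fun k => (X k).1)
      (Q := fun k => DirectSum (ι (X k)) fun i => T (X k) i) c (fun k => hmono k.le_succ) ?_ hcM
      (fun k => π (X k)) (fun k => hπs (X k)) (fun k x => (hπ (X k) x).trans ?_)
      fun k => hasHill_directSum hS _ (hT (X k))
    · rw [LinearMap.range_eq_bot]
      exact LinearMap.ext fun x => by
        rw [show x = 0 from Subsingleton.elim (α := PUnit) _ _, map_zero, map_zero]
    · constructor
      · rintro ⟨y, rfl⟩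
        exact ⟨y, (hcj k y).symm⟩
      · rintro ⟨y, hy⟩
        exact ⟨y, hc (k + 1) ((hcj k y).trans hy)⟩
  have small : ∀ U : Submodule R M, U.FG → ∃ k, U ≤ LinearMap.range (c k) := by
    intro U hU
    induction U, hU using Submodule.fg_induction with
    | singleton x =>
      obtain ⟨k, hk⟩ := hcM x
      exact ⟨k, (Submodule.span_singleton_le_iff_mem _ _).2 hk⟩
    | sup U₁ U₂ _ _ h₁ h₂ =>
      obtain ⟨k, hk⟩ := h₁
      obtain ⟨l, hl⟩ := h₂
      exact ⟨max k l, sup_le (hk.trans (hmono (le_max_left k l)))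
        (hl.trans (hmono (le_max_right k l)))⟩
  have lift : ∀ (n : ℕ) (K : Submodule R (Fin n → R)), ModuleCat.of R ((Fin n → R) ⧸ K) ∈ S →
      ∀ (g : K →ₗ[R] M) (h : (Fin n → R) →ₗ[R] A), (∀ k, q (g k) = h k) →
      ∃ e : (Fin n → R) →ₗ[R] M, (∀ k : K, e k = g k) ∧ ∀ x, q (e x) = h x := by
    intro n K hK g h w
    have hKfg : K.FG := by
      have := hS.fp _ hK
      have := Module.FinitePresentation.fg_ker K.mkQ K.mkQ_surjective
      rwa [K.ker_mkQ] at this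
    have := Module.Finite.of_fg hKfg
    obtain ⟨k, hk⟩ := small (LinearMap.range g) (Module.Finite.fg_top.map g |> fun h => by
      rwa [Submodule.map_top] at h)
    let e := LinearEquiv.ofInjective (c k) (hc k)
    let g' : K →ₗ[R] (X k).1 := e.symm.toLinearMap ∘ₗ g.codRestrict _ fun x => hk ⟨x, rfl⟩
    have hg' : ∀ x, c k (g' x) = g x := fun x =>
      congrArg Subtype.val (e.apply_symm_apply ⟨g x, hk ⟨x, rfl⟩⟩)
    obtain ⟨e', he', hh⟩ := hE (X k) n K hK g' h fun x => by rw [← hq k, hg', w]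
    refine ⟨c (k + 1) ∘ₗ e', fun x => ?_, fun x => (hq (k + 1) _).trans (hh x)⟩
    rw [LinearMap.comp_apply, he', ← hg']
    exact hcj k _
  refine ⟨M, q, hill, fun a => ?_, fun X hX => ?_⟩
  · have h1 : ModuleCat.of R ((Fin 1 → R) ⧸ (⊥ : Submodule R (Fin 1 → R))) ∈ S :=
      hS.of_linearEquiv ((LinearEquiv.funUnique (Fin 1) R R).symm ≪≫ₗ
        (Submodule.quotEquivOfEqBot ⊥ rfl).symm) hS.free
    obtain ⟨e, -, he⟩ := lift 1 ⊥ h1 0 (LinearMap.toSpanSingleton R A a ∘ₗ LinearMap.proj 0)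
      fun k => by simp [(Submodule.mem_bot R).1 k.2]
    exact ⟨e 1, by simp [he]⟩
  · have := hS.fp X hX
    obtain ⟨n, f, hf⟩ := Module.Finite.exists_fin' R X
    refine ext1Zero_of_exists_extension (K := LinearMap.ker f) (fun g => ?_) f hf rfl
    obtain ⟨e, he, he'⟩ := lift n (LinearMap.ker f)
      (hS.of_linearEquiv (f.quotKerEquivOfSurjective hf).symm hX)
      ((LinearMap.ker q).subtype ∘ₗ g) 0 fun k => (g k).2
    exact ⟨e.codRestrict _ he', fun x => Subtype.ext (he x)⟩

theorem exists_hasHill_prod (hS : Admissible S)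
    (hA : ModuleCat.of R A ∈ leftPerp (rightPerp S)) :
    ∃ Q : ModuleCat.{u} R, HasHill S Q ∧ HasHill S (A × Q) := by
  obtain ⟨F, p, hF, hp, hK⟩ := exists_hasHill_cover hS A
  let B := LinearMap.ker p
  obtain ⟨s, hs⟩ := (hA _ hK).exists_section B.subtype p Subtype.val_injective
    (fun x => ⟨fun hx => ⟨⟨x, hx⟩, rfl⟩, fun ⟨y, hy⟩ => hy ▸ y.2⟩) hp
  let e : (A × B) ≃ₗ[R] F := LinearEquiv.ofBijective (s.coprod B.subtype) (by
    constructor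
    · rw [injective_iff_map_eq_zero]
      rintro ⟨a, b⟩ hab
      have h1 : s a + b = 0 := hab
      have h2 := congrArg p h1
      rw [map_add, hs, LinearMap.mem_ker.1 b.2, add_zero, map_zero] at h2
      rw [h2, map_zero, zero_add] at h1
      exact Prod.ext h2 (Subtype.ext h1)
    · intro x
      refine ⟨(p x, ⟨x - s (p x), ?_⟩), ?_⟩
      · rw [LinearMap.mem_ker, map_sub, hs, sub_self]
      · simp)
  let split : (ℕ →₀ A × B) ≃ₗ[R] (ℕ →₀ A) × (ℕ →₀ B) := LinearEquiv.ofLinearMap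
    ((Finsupp.mapRange.linearMap (LinearMap.fst R A B)).prod
      (Finsupp.mapRange.linearMap (LinearMap.snd R A B)))
    ((Finsupp.mapRange.linearMap (LinearMap.inl R A B)).coprod
      (Finsupp.mapRange.linearMap (LinearMap.inr R A B)))
    (by
      refine LinearMap.ext fun x => ?_
      ext <;> simp)
    (by
      refine LinearMap.ext fun x => ?_
      ext <;> simp)
  let shift : (A × (ℕ →₀ A)) ≃ₗ[R] (ℕ →₀ A) :=
    LinearEquiv.prodComm R _ _ ≪≫ₗ
      (LinearEquiv.refl R (ℕ →₀ A)).prodCongr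
        (Finsupp.uniqueLinearEquiv R A PUnit.unit.{u + 1}).symm ≪≫ₗ
      (Finsupp.sumFinsuppLEquivProdFinsupp R).symm ≪≫ₗ
      Finsupp.domLCongr Equiv.natSumPUnitEquivNat
  have hQ : HasHill S (ℕ →₀ A × B) := (hF.of_linearEquiv hS e.symm).finsupp hS
  refine ⟨ModuleCat.of R (ℕ →₀ A × B), hQ, hQ.of_linearEquiv hS (split ≪≫ₗ
    shift.symm.prodCongr (LinearEquiv.refl R _) ≪≫ₗ LinearEquiv.prodAssoc R _ _ _ ≪≫ₗ
    (LinearEquiv.refl R A).prodCongr split.symm)⟩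

end SmallObject

section Purity

theorem exists_factorization (M : Type u) [AddCommGroup M] [Module R M]
    [Module.FinitePresentation R M] {Z : ModuleCat.{u} R} (hZ : Z ∈ limClosure S) (g : M →ₗ[R] Z) :
    ∃ (T : ModuleCat.{u} R) (a : M →ₗ[R] T) (b : T →ₗ[R] Z), T ∈ S ∧ ∀ m, b (a m) = g m := by
  obtain ⟨D⟩ := hZ
  let := D.po
  have := D.dir
  have := D.ne
  let b : ∀ i, D.F.obj i →ₗ[R] Z := fun i => (D.c.ι.app i ≫ D.iso.hom).hom
  have hb : ∀ {i j} (u : i ⟶ j) x, b j ((D.F.map u).hom x) = b i x := fun u x =>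
    congrArg (fun t => D.iso.hom.hom (t.hom x)) (D.c.w u)
  have hbs : ∀ z, ∃ i y, b i y = z := fun z => by
    obtain ⟨i, y, hy⟩ := Concrete.isColimit_exists_rep D.F D.hc (D.iso.inv.hom z)
    refine ⟨i, y, (congrArg D.iso.hom.hom hy).trans ?_⟩
    exact congrArg (fun t => t.hom z) D.iso.inv_hom_id
  have hbk : ∀ i x, b i x = 0 → ∃ (j : D.I) (u : i ⟶ j), (D.F.map u).hom x = 0 := fun i x hx => by
    have hx' : D.c.ι.app i x = D.c.ι.app i 0 := by
      refine (ConcreteCategory.bijective_of_isIso D.iso.hom).1 ?_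
      exact hx.trans (map_zero (b i)).symm
    obtain ⟨j, u, v, h⟩ := (Concrete.isColimit_rep_eq_iff_exists D.F D.hc x 0).1 hx'
    exact ⟨j, u, h.trans (map_zero _)⟩
  obtain ⟨n, π, hπ⟩ := Module.Finite.exists_fin' R M
  choose i y hy using fun l : Fin n => hbs (g (π (Pi.single l 1)))
  obtain ⟨i₀, hi₀⟩ := Finite.exists_le i
  let e : (Fin n → R) →ₗ[R] D.F.obj i₀ :=
    (Pi.basisFun R (Fin n)).constr ℕ fun l => (D.F.map (homOfLE (hi₀ l))).hom (y l)
  have he : b i₀ ∘ₗ e = g ∘ₗ π := (Pi.basisFun R (Fin n)).ext fun l => by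
    rw [LinearMap.comp_apply, Module.Basis.constr_basis, hb, hy, LinearMap.comp_apply,
      Pi.basisFun_apply]
  have kill : ∀ U : Submodule R (Fin n → R), U.FG → U ≤ LinearMap.ker π →
      ∃ (j : D.I) (u : i₀ ⟶ j), U ≤ LinearMap.ker ((D.F.map u).hom ∘ₗ e) := by
    intro U hU
    induction U, hU using Submodule.fg_induction with
    | singleton x =>
      intro hx
      rw [Submodule.span_singleton_le_iff_mem, LinearMap.mem_ker] at hx
      obtain ⟨j, u, hu⟩ := hbk i₀ (e x) ((LinearMap.congr_fun he x).trans (by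
        rw [LinearMap.comp_apply, hx, map_zero]))
      exact ⟨j, u, (Submodule.span_singleton_le_iff_mem _ _).2 hu⟩
    | sup U₁ U₂ _ _ h₁ h₂ =>
      intro h
      obtain ⟨j₁, u₁, k₁⟩ := h₁ (le_sup_left.trans h)
      obtain ⟨j₂, u₂, k₂⟩ := h₂ (le_sup_right.trans h)
      obtain ⟨j, l₁, l₂⟩ := exists_ge_ge j₁ j₂
      refine ⟨j, u₁ ≫ homOfLE l₁, sup_le (fun x hx => ?_) fun x hx => ?_⟩
      · have := LinearMap.mem_ker.1 (k₁ hx)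
        rw [LinearMap.comp_apply] at this
        rw [LinearMap.mem_ker, LinearMap.comp_apply, D.F.map_comp, ModuleCat.hom_comp,
          LinearMap.comp_apply, this, map_zero]
      · have := LinearMap.mem_ker.1 (k₂ hx)
        rw [LinearMap.comp_apply] at this
        rw [LinearMap.mem_ker, LinearMap.comp_apply, Subsingleton.elim (u₁ ≫ homOfLE l₁)
          (u₂ ≫ homOfLE l₂), D.F.map_comp, ModuleCat.hom_comp, LinearMap.comp_apply, this, map_zero]
  obtain ⟨j, u, hu⟩ := kill _ (Module.FinitePresentation.fg_ker π hπ) le_rfl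
  let q := LinearMap.quotKerEquivOfSurjective π hπ
  refine ⟨D.F.obj j, (LinearMap.ker π).liftQ _ hu ∘ₗ q.symm.toLinearMap, b j, D.mem j, fun m => ?_⟩
  obtain ⟨x, rfl⟩ := hπ m
  have hq : q.symm (π x) = (LinearMap.ker π).mkQ x := (LinearEquiv.symm_apply_eq q).2 rfl
  rw [LinearMap.comp_apply, LinearEquiv.coe_coe, hq]
  exact (hb u (e x)).trans (LinearMap.congr_fun he x)

theorem exists_lift_of_mem_limClosure {Z E Z' : Type u} [AddCommGroup Z] [Module R Z]
    [AddCommGroup E] [Module R E] [AddCommGroup Z'] [Module R Z']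
    (hZ : ModuleCat.of R Z ∈ rightPerp S) (hZ' : ModuleCat.of R Z' ∈ limClosure S)
    (i : Z →ₗ[R] E) (p : E →ₗ[R] Z') (hi : Function.Injective i) (hip : Function.Exact i p)
    (hp : Function.Surjective p) (M : Type u) [AddCommGroup M] [Module R M]
    [Module.FinitePresentation R M] (g : M →ₗ[R] Z') : ∃ t : M →ₗ[R] E, ∀ m, p (t m) = g m := by
  obtain ⟨T, a, b, hT, hab⟩ := exists_factorization M hZ' g
  obtain ⟨t, ht⟩ := Ext1Zero.exists_lift (M := T) (hZ T hT) i p hi hip hp b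
  exact ⟨t ∘ₗ a, fun m => (ht (a m)).trans (hab m)⟩

end Purity

section Homotopy

theorem exists_int_shift {β : ℤ → Type*} (v : ∀ n, β (n + 1)) :
    ∃ w : ∀ n, β n, ∀ n, w (n + 1) = v n := by
  refine ⟨fun n => (sub_add_cancel n 1) ▸ v (n - 1), fun n => ?_⟩
  have : ∀ m (h : m + 1 = n + 1), h ▸ v m = v n := by
    intro m h
    obtain rfl : m = n := by omega
    rfl
  exact this _ _

variable {X : ℤ → Type u} [∀ n, AddCommGroup (X n)] [∀ n, Module R (X n)]

/-- Every map from a finitely presented module to the cycles of `X` lifts along the differential. -/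
def IsPureAcyclic (dX : ∀ n, X n →ₗ[R] X (n + 1)) : Prop :=
  ∀ (n : ℤ) (M : Type u) [AddCommGroup M] [Module R M] [Module.FinitePresentation R M]
    (g : M →ₗ[R] X (n + 1)), (∀ m, dX (n + 1) (g m) = 0) → ∃ t : M →ₗ[R] X n, ∀ m, dX n (t m) = g m

theorem IsPureAcyclic.exists_lift_of_le_ker {dX : ∀ n, X n →ₗ[R] X (n + 1)} (hX : IsPureAcyclic dX)
    {n : ℤ} {M : Type u} [AddCommGroup M] [Module R M] (B : Submodule R M)
    [Module.FinitePresentation R (M ⧸ B)] (g : M →ₗ[R] X (n + 1)) (hg : ∀ m, dX (n + 1) (g m) = 0)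
    (hB : ∀ b ∈ B, g b = 0) :
    ∃ t : M →ₗ[R] X n, (∀ m, dX n (t m) = g m) ∧ ∀ b ∈ B, t b = 0 := by
  obtain ⟨t, ht⟩ := hX n (M ⧸ B) (B.liftQ g hB) fun m => by
    obtain ⟨m, rfl⟩ := B.mkQ_surjective m
    exact hg m
  refine ⟨t ∘ₗ B.mkQ, fun m => ht (B.mkQ m), fun b hb => ?_⟩
  have : B.mkQ b = 0 := (Submodule.Quotient.mk_eq_zero B).2 hb
  rw [LinearMap.comp_apply, this, map_zero]

theorem IsPureAcyclic.exists_homotopy {dX : ∀ n, X n →ₗ[R] X (n + 1)} (hX : IsPureAcyclic dX)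
    {P : ℤ → Type u} [∀ n, AddCommGroup (P n)] [∀ n, Module R (P n)]
    [∀ n, Module.FinitePresentation R (P n)] (dP : ∀ n, P n →ₗ[R] P (n + 1))
    (hdP : ∀ n x, dP (n + 1) (dP n x) = 0) (f : ∀ n, P n →ₗ[R] X (n + 1))
    (hf : ∀ n x, dX (n + 1) (f n x) = f (n + 1) (dP n x)) :
    ∃ s : ∀ n, P n →ₗ[R] X n, ∀ n x, f n x = dX n (s n x) + s (n + 1) (dP n x) := by
  obtain ⟨B, hB⟩ := exists_int_shift (β := fun n => Submodule R (P n))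
    fun n => LinearMap.range (dP n)
  have hdB : ∀ n x, dP n x ∈ B (n + 1) := fun n x => hB n ▸ ⟨x, rfl⟩
  have hBd : ∀ n, ∀ b ∈ B n, dP n b = 0 := by
    intro n b hb
    obtain ⟨n, rfl⟩ : ∃ m, n = m + 1 := ⟨n - 1, by omega⟩
    rw [hB] at hb
    obtain ⟨x, rfl⟩ := hb
    exact hdP n x
  have hfp : ∀ n, Module.FinitePresentation R (P n ⧸ B n) := by
    intro n
    refine Module.finitePresentation_of_surjective (B n).mkQ (B n).mkQ_surjective ?_
    obtain ⟨n, rfl⟩ : ∃ m, n = m + 1 := ⟨n - 1, by omega⟩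
    rw [Submodule.ker_mkQ, hB, LinearMap.range_eq_map]
    exact Module.Finite.fg_top.map _
  choose t ht htB using fun n => hX.exists_lift_of_le_ker (n := n + 1) (B n) (dX (n + 1) ∘ₗ f n)
    (fun x => by rw [LinearMap.comp_apply, hf, hf, hdP, map_zero])
    fun b hb => by rw [LinearMap.comp_apply, hf, hBd n b hb, map_zero]
  choose s hs using fun n => hX n (P n) (f n - t n) fun x => by
    rw [LinearMap.sub_apply, map_sub, ht, LinearMap.comp_apply, sub_self]
  choose s' hs' hs'B using fun n => hX.exists_lift_of_le_ker (n := n) (B n)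
    (t n - s (n + 1) ∘ₗ dP n)
    (fun x => by
      rw [LinearMap.sub_apply, map_sub, ht, LinearMap.comp_apply, LinearMap.comp_apply, hs,
        LinearMap.sub_apply, htB (n + 1) _ (hdB n x), hf, sub_zero, sub_self])
    fun b hb => by
      rw [LinearMap.sub_apply, LinearMap.comp_apply, htB n b hb, hBd n b hb, map_zero, sub_zero]
  refine ⟨fun n => s n + s' n, fun n x => ?_⟩
  rw [LinearMap.add_apply, LinearMap.add_apply, map_add, hs, hs', hs'B (n + 1) _ (hdB n x),
    LinearMap.sub_apply, LinearMap.sub_apply, LinearMap.comp_apply]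
  abel

theorem IsPureAcyclic.exists_homotopy_extension (hS : Admissible S)
    {dX : ∀ n, X n →ₗ[R] X (n + 1)} (hX : IsPureAcyclic dX)
    (hdX : ∀ n x, dX (n + 1) (dX n x) = 0) (hXS : ∀ n, ModuleCat.of R (X n) ∈ rightPerp S)
    {N : ℤ → Type u} [∀ n, AddCommGroup (N n)] [∀ n, Module R (N n)]
    (dN : ∀ n, N n →ₗ[R] N (n + 1)) (hdN : ∀ n x, dN (n + 1) (dN n x) = 0)
    (K : ∀ n, Submodule R (N n)) (hK : ∀ n, ∀ x ∈ K n, dN n x ∈ K (n + 1))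
    (hKS : ∀ n, ModuleCat.of R (N n ⧸ K n) ∈ S) (f : ∀ n, N n →ₗ[R] X (n + 1))
    (hf : ∀ n x, dX (n + 1) (f n x) = f (n + 1) (dN n x)) (s : ∀ n, K n →ₗ[R] X n)
    (hs : ∀ n (x : K n), f n x = dX n (s n x) + s (n + 1) ⟨dN n x, hK n x x.2⟩) :
    ∃ s' : ∀ n, N n →ₗ[R] X n, (∀ n x, f n x = dX n (s' n x) + s' (n + 1) (dN n x)) ∧
      ∀ n (x : K n), s' n x = s n x := by
  choose r hr using fun n => Ext1Zero.exists_extension (hXS n _ (hKS n)) (s n)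
  have hK0 : ∀ n, K n ≤ LinearMap.ker (f n - dX n ∘ₗ r n - r (n + 1) ∘ₗ dN n) := fun n x hx => by
    have h1 := hr n ⟨x, hx⟩
    have h2 := hr (n + 1) ⟨dN n x, hK n x hx⟩
    have h3 := hs n ⟨x, hx⟩
    simp only at h1 h2 h3
    simp [h1, h2, h3]
  have := fun n => hS.fp _ (hKS n)
  obtain ⟨t, ht⟩ := hX.exists_homotopy (fun n => (K n).mapQ (K (n + 1)) (dN n) (hK n))
    (fun n x => by
      obtain ⟨x, rfl⟩ := (K n).mkQ_surjective x
      simp [hdN])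
    (fun n => (K n).liftQ _ (hK0 n))
    (fun n x => by
      obtain ⟨x, rfl⟩ := (K n).mkQ_surjective x
      simp [hdN, hdX, hf])
  refine ⟨fun n => r n + t n ∘ₗ (K n).mkQ, fun n x => ?_, fun n x => ?_⟩
  · have h := ht n ((K n).mkQ x)
    simp only [Submodule.mkQ_apply, Submodule.liftQ_apply, Submodule.mapQ_apply,
      LinearMap.sub_apply, sub_sub, sub_eq_iff_eq_add] at h
    simp only [LinearMap.add_apply, LinearMap.comp_apply, Submodule.mkQ_apply, map_add]
    rw [h, LinearMap.add_apply, LinearMap.comp_apply, LinearMap.comp_apply]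
    abel
  · have : (K n).mkQ x = 0 := (Submodule.Quotient.mk_eq_zero _).2 x.2
    rw [LinearMap.add_apply, LinearMap.comp_apply, this, map_zero, add_zero, hr]

end Homotopy

section Zorn

variable {M : ℤ → Type u} [∀ n, AddCommGroup (M n)] [∀ n, Module R (M n)]

theorem IsHill.exists_rel_complex (hS : Admissible S) {H : ∀ n, Set (Submodule R (M n))}
    (hH : ∀ n, IsHill S (H n)) (dM : ∀ n, M n →ₗ[R] M (n + 1)) {L : ∀ n, Submodule R (M n)}
    (hL : ∀ n, L n ∈ H n) (hdL : ∀ n, ∀ x ∈ L n, dM n x ∈ L (n + 1)) (b : ℤ) (x : M b) :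
    ∃ L' : ∀ n, Submodule R (M n), (∀ n, L' n ∈ H n) ∧ (∀ n, RelIn S (L n) (L' n)) ∧
      (∀ n, ∀ x ∈ L' n, dM n x ∈ L' (n + 1)) ∧ x ∈ L' b := by
  have hnext : ∀ n (U : Submodule R (M n)), ∃ W : Submodule R (M (n + 1)),
      U ∈ H n → RelIn S (L n) U →
        W ∈ H (n + 1) ∧ RelIn S (L (n + 1)) W ∧ ∀ x ∈ U, dM n x ∈ W := by
    intro n U
    by_cases hU : RelIn S (L n) U
    · obtain ⟨V, hV, rfl⟩ := hU.exists_fg hS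
      obtain ⟨W, hW, hVW, hLW⟩ :=
        (hH (n + 1)).exists_rel_of_fg hS (hV.map (dM n)) _ (hL (n + 1))
      refine ⟨W, fun _ _ => ⟨hW, hLW, fun x hx => ?_⟩⟩
      obtain ⟨l, hl, v, hv, rfl⟩ := Submodule.mem_sup.1 hx
      rw [map_add]
      exact add_mem (hLW.1 (hdL n l hl)) (hVW ⟨v, hv, rfl⟩)
    · exact ⟨⊥, fun _ h => (hU h).elim⟩
  choose next hnextH hnextR hnextd using hnext
  obtain ⟨U, hU, hxU, hLU⟩ := (hH b).exists_rel (L b) (hL b) x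
  let L' : ∀ n, Submodule R (M n) := fun n =>
    Int.inductionOn' (motive := fun n => Submodule R (M n)) n b U (fun k _ W => next k W)
      fun k _ _ => L (k - 1)
  have h0 : L' b = U := Int.inductionOn'_self ..
  have h1 : ∀ n, b ≤ n → L' (n + 1) = next n (L' n) := fun n hn =>
    Int.inductionOn'_add_one hn
  have h2 : ∀ n, n < b → L' n = L n := by
    intro n hn
    obtain ⟨n, rfl⟩ : ∃ m, n = m - 1 := ⟨n + 1, by omega⟩
    exact Int.inductionOn'_sub_one (by omega)
  have h3 : ∀ n, b ≤ n → L' n ∈ H n ∧ RelIn S (L n) (L' n) := by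
    refine fun n hn => Int.leInduction (h0 ▸ ⟨hU, hLU⟩) (fun n hn h => ?_) n hn
    rw [h1 n hn]
    exact ⟨hnextH _ _ h.1 h.2, hnextR _ _ h.1 h.2⟩
  have h4 : ∀ n, L' n ∈ H n ∧ RelIn S (L n) (L' n) := by
    intro n
    rcases le_or_gt b n with hn | hn
    · exact h3 n hn
    · rw [h2 n hn]
      exact ⟨hL n, RelIn.refl hS _⟩
  refine ⟨L', fun n => (h4 n).1, fun n => (h4 n).2, fun n x hx => ?_, h0 ▸ hxU⟩
  rcases le_or_gt b n with hn | hn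
  · rw [h1 n hn]
    exact hnextd _ _ (h4 n).1 (h4 n).2 x hx
  · rw [h2 n hn] at hx
    exact (h4 (n + 1)).2.1 (hdL n x hx)

variable {X : ℤ → Type u} [∀ n, AddCommGroup (X n)] [∀ n, Module R (X n)]

/-- A null-homotopy of `f` defined on a subcomplex whose terms belong to `H`. -/
structure IsPartialHomotopy (H : ∀ n, Set (Submodule R (M n))) (dX : ∀ n, X n →ₗ[R] X (n + 1))
    (dM : ∀ n, M n →ₗ[R] M (n + 1)) (f : ∀ n, M n →ₗ[R] X (n + 1)) (s : ∀ n, M n →ₗ.[R] X n) :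
    Prop where
  domain_mem : ∀ n, (s n).domain ∈ H n
  d_mem : ∀ n, ∀ x ∈ (s n).domain, dM n x ∈ (s (n + 1)).domain
  comm : ∀ n (x : (s n).domain) (y : (s (n + 1)).domain), (y : M (n + 1)) = dM n x →
    f n x = dX n (s n x) + s (n + 1) y

variable {H : ∀ n, Set (Submodule R (M n))} {dX : ∀ n, X n →ₗ[R] X (n + 1)}
  {dM : ∀ n, M n →ₗ[R] M (n + 1)} {f : ∀ n, M n →ₗ[R] X (n + 1)}

theorem IsPartialHomotopy.bot (hH : ∀ n, IsHill S (H n)) : IsPartialHomotopy H dX dM f ⊥ where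
  domain_mem n := (hH n).bot_mem
  d_mem n x hx := by
    rw [(Submodule.mem_bot R).1 hx, map_zero]
    exact Submodule.zero_mem _
  comm n x y hy := by
    obtain rfl : x = 0 := Subtype.ext ((Submodule.mem_bot R).1 x.2)
    obtain rfl : y = 0 := Subtype.ext (by simpa using hy)
    simp

theorem IsPartialHomotopy.exists_upperBound (hH : ∀ n, IsHill S (H n))
    {c : Set (∀ n, M n →ₗ.[R] X n)} (hc : ∀ s ∈ c, IsPartialHomotopy H dX dM f s)
    (hchain : IsChain (· ≤ ·) c) (hne : c.Nonempty) :
    ∃ t, IsPartialHomotopy H dX dM f t ∧ ∀ s ∈ c, s ≤ t := by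
  have hch : ∀ n, IsChain (· ≤ ·) ((fun s : ∀ n, M n →ₗ.[R] X n => s n) '' c) := fun n =>
    hchain.image_of_map_rel _ _ _ fun _ _ h => h n
  have hdir := fun n => (hch n).directedOn
  have hle : ∀ s ∈ c, ∀ n, s n ≤ LinearPMap.sSup _ (hdir n) := fun s hs n =>
    LinearPMap.le_sSup _ ⟨s, hs, rfl⟩
  have hmem : ∀ n, ∀ x ∈ (LinearPMap.sSup _ (hdir n)).domain, ∃ s ∈ c, x ∈ (s n).domain := by
    intro n x hx
    obtain ⟨-, ⟨s, hs, rfl⟩, hx⟩ := (LinearPMap.mem_domain_sSup_iff (hne.image _) (hdir n)).1 hx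
    exact ⟨s, hs, hx⟩
  refine ⟨fun n => LinearPMap.sSup _ (hdir n), ⟨fun n => ?_, fun n x hx => ?_, fun n x y hy => ?_⟩,
    hle⟩
  · refine (hH n).sSup_mem _ ?_ ((hne.image _).image _)
      ((hch n).image_of_map_rel _ _ _ fun _ _ h => h.1)
    rintro _ ⟨_, ⟨s, hs, rfl⟩, rfl⟩
    exact (hc s hs).domain_mem n
  · obtain ⟨s, hs, hx⟩ := hmem n x hx
    exact (hle s hs _).1 ((hc s hs).d_mem n x hx)
  · obtain ⟨s, hs, hx⟩ := hmem n x x.2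
    have hd := (hc s hs).d_mem n x hx
    rw [(hc s hs).comm n ⟨x, hx⟩ ⟨_, hd⟩ rfl, (hle s hs n).2 (x := ⟨x, hx⟩) (y := x) rfl,
      (hle s hs (n + 1)).2 (x := ⟨_, hd⟩) (y := y) hy.symm]

theorem IsPartialHomotopy.exists_extension (hS : Admissible S) (hH : ∀ n, IsHill S (H n))
    (hX : IsPureAcyclic dX) (hdX : ∀ n x, dX (n + 1) (dX n x) = 0)
    (hXS : ∀ n, ModuleCat.of R (X n) ∈ rightPerp S) (hdM : ∀ n x, dM (n + 1) (dM n x) = 0)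
    (hf : ∀ n x, dX (n + 1) (f n x) = f (n + 1) (dM n x)) {s : ∀ n, M n →ₗ.[R] X n}
    (hs : IsPartialHomotopy H dX dM f s) (b : ℤ) (x : M b) :
    ∃ t, IsPartialHomotopy H dX dM f t ∧ s ≤ t ∧ x ∈ (t b).domain := by
  obtain ⟨L, hL, hsL, hdL, hx⟩ := IsHill.exists_rel_complex hS hH dM hs.domain_mem hs.d_mem b x
  obtain ⟨t, ht, hst⟩ := hX.exists_homotopy_extension hS hdX hXS (N := fun n => L n)
    (fun n => (dM n).restrict (hdL n)) (fun n x => Subtype.ext (hdM n x))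
    (fun n => (s n).domain.submoduleOf (L n)) (fun n x hx => hs.d_mem n x hx)
    (fun n => (hsL n).2) (fun n => f n ∘ₗ (L n).subtype) (fun n x => hf n x)
    (fun n => (s n).toFun ∘ₗ (((L n).subtype).restrict fun x hx => hx))
    fun n x => hs.comm n ⟨x.1, x.2⟩ ⟨dM n x, hs.d_mem n x x.2⟩ rfl
  refine ⟨fun n => ⟨L n, t n⟩, ⟨hL, hdL, fun n x y hy => ?_⟩, fun n => ⟨(hsL n).1, ?_⟩, hx⟩
  · obtain rfl : y = ⟨dM n x, hdL n x x.2⟩ := Subtype.ext hy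
    exact ht n x
  · rintro x y hxy
    have h : (y : M n) ∈ (s n).domain := hxy ▸ x.2
    obtain rfl : x = ⟨y, h⟩ := Subtype.ext hxy
    exact (hst n ⟨y, h⟩).symm

theorem IsPureAcyclic.exists_homotopy_of_hasHill (hS : Admissible S) (hM : ∀ n, HasHill S (M n))
    (hX : IsPureAcyclic dX) (hdX : ∀ n x, dX (n + 1) (dX n x) = 0)
    (hXS : ∀ n, ModuleCat.of R (X n) ∈ rightPerp S) (hdM : ∀ n x, dM (n + 1) (dM n x) = 0)
    (hf : ∀ n x, dX (n + 1) (f n x) = f (n + 1) (dM n x)) :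
    ∃ s : ∀ n, M n →ₗ[R] X n, ∀ n x, f n x = dX n (s n x) + s (n + 1) (dM n x) := by
  choose H hH using hM
  obtain ⟨s, -, hs⟩ := zorn_le_nonempty₀ {s | IsPartialHomotopy H dX dM f s}
    (fun c hc hchain y hy => IsPartialHomotopy.exists_upperBound hH hc hchain ⟨y, hy⟩) ⊥
    (IsPartialHomotopy.bot hH)
  have hsH : IsPartialHomotopy H dX dM f s := hs.prop
  have htop : ∀ n x, x ∈ (s n).domain := by
    intro n x
    obtain ⟨t, ht, hst, hx⟩ := hsH.exists_extension hS hH hX hdX hXS hdM hf n x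
    exact (hs.le_of_ge ht hst n).1 hx
  exact ⟨fun n => (s n).toFun ∘ₗ LinearMap.id.codRestrict _ (htop n), fun n x =>
    hsH.comm n ⟨x, htop n x⟩ ⟨_, htop _ _⟩ rfl⟩

end Zorn

section Complexes

theorem IsPureAcyclic.exists_homotopy_of_mem_leftPerp (hS : Admissible S)
    {A X : ℤ → Type u} [∀ n, AddCommGroup (A n)] [∀ n, Module R (A n)]
    [∀ n, AddCommGroup (X n)] [∀ n, Module R (X n)] {dX : ∀ n, X n →ₗ[R] X (n + 1)}
    {dA : ∀ n, A n →ₗ[R] A (n + 1)} {f : ∀ n, A n →ₗ[R] X (n + 1)}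
    (hA : ∀ n, ModuleCat.of R (A n) ∈ leftPerp (rightPerp S))
    (hX : IsPureAcyclic dX) (hdX : ∀ n x, dX (n + 1) (dX n x) = 0)
    (hXS : ∀ n, ModuleCat.of R (X n) ∈ rightPerp S) (hdA : ∀ n x, dA (n + 1) (dA n x) = 0)
    (hf : ∀ n x, dX (n + 1) (f n x) = f (n + 1) (dA n x)) :
    ∃ s : ∀ n, A n →ₗ[R] X n, ∀ n x, f n x = dX n (s n x) + s (n + 1) (dA n x) := by
  choose Q hQ hAQ using fun n => exists_hasHill_prod hS (hA n)
  obtain ⟨s, hs⟩ := hX.exists_homotopy_of_hasHill hS (M := fun n => A n × Q n × Q (n + 1))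
    (dM := fun n => (dA n).prodMap (LinearMap.inl R _ _ ∘ₗ LinearMap.snd R _ _))
    (f := fun n => f n ∘ₗ LinearMap.fst R _ _)
    (fun n => ((hAQ n).prod hS (hQ (n + 1))).of_linearEquiv hS (LinearEquiv.prodAssoc R _ _ _))
    hdX hXS (fun n x => by simp [hdA]) fun n x => by simp [hf]
  refine ⟨fun n => s n ∘ₗ LinearMap.inl R _ _, fun n x => ?_⟩
  simpa [← Prod.zero_eq_mk] using hs n (x, 0)

theorem isPureAcyclic_of_isAcyclic {X : CochainComplex (ModuleCat.{u} R) ℤ} (hX : IsAcyclic X)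
    (hK : ∀ n : ℤ, kernel (X.d n (n + 1)) ∈ rightPerp S ∩ limClosure S) :
    IsPureAcyclic fun n => (X.d n (n + 1)).hom := by
  intro n M _ _ _ g hg
  let p := kernel.lift (X.d (n + 1) (n + 1 + 1)) (X.d n (n + 1)) (X.d_comp_d _ _ _)
  have hp : ∀ x, (kernel.ι (X.d (n + 1) (n + 1 + 1))).hom (p.hom x) = (X.d n (n + 1)).hom x :=
    fun x => congr($(kernel.lift_ι _ _ (X.d_comp_d n (n + 1) (n + 1 + 1))).hom x)
  have hker : ∀ k (y : (kernel (X.d k (k + 1)) : ModuleCat.{u} R)),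
      (X.d k (k + 1)).hom ((kernel.ι (X.d k (k + 1))).hom y) = 0 :=
    fun k y => congr($(kernel.condition (X.d k (k + 1))).hom y)
  have hlift : ∀ k (x : X.X k), (X.d k (k + 1)).hom x = 0 →
      ∃ y, (kernel.ι (X.d k (k + 1))).hom y = x := by
    intro k x hx
    refine ⟨(ModuleCat.kernelIsoKer (X.d k (k + 1))).inv.hom ⟨x, hx⟩, ?_⟩
    exact congr($(ModuleCat.kernelIsoKer_inv_kernel_ι (X.d k (k + 1))).hom ⟨x, hx⟩)
  have hinj : ∀ k, Function.Injective (kernel.ι (X.d k (k + 1))).hom :=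
    fun k => (ModuleCat.mono_iff_injective _).1 inferInstance
  choose y hy using fun m => hlift (n + 1) (g m) (hg m)
  have hexact : Function.Exact (kernel.ι (X.d n (n + 1))).hom p.hom := by
    intro x
    rw [← (hinj (n + 1)).eq_iff, hp, map_zero]
    exact ⟨fun h => hlift n x h, by rintro ⟨z, rfl⟩; exact hker n z⟩
  have hsurj : Function.Surjective p.hom := by
    intro z
    have h := (X.exactAt_iff' n (n + 1) (n + 1 + 1) (by simp) (by simp)).1 (hX (n + 1))
    rw [ShortComplex.moduleCat_exact_iff] at h
    obtain ⟨x, hx⟩ := h _ (hker _ z)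
    exact ⟨x, hinj _ ((hp x).trans hx)⟩
  obtain ⟨t, ht⟩ := exists_lift_of_mem_limClosure (hK n).1 (hK (n + 1)).2
    (kernel.ι (X.d n (n + 1))).hom p.hom (hinj n) hexact hsurj M
    { toFun := y
      map_add' := fun a b => hinj _ (by simp [hy])
      map_smul' := fun a b => hinj _ (by simp [hy]) }
  refine ⟨t, fun m => ?_⟩
  rw [← hp, ht]
  exact hy m

theorem nonempty_homotopy_zero {A X : CochainComplex (ModuleCat.{u} R) ℤ} (f : A ⟶ X)
    (s : ∀ n : ℤ, A.X (n + 1) →ₗ[R] X.X n)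
    (hs : ∀ n (x : A.X (n + 1)), (f.f (n + 1)).hom x = (X.d n (n + 1)).hom (s n x) +
      s (n + 1) ((A.d (n + 1) (n + 1 + 1)).hom x)) :
    Nonempty (Homotopy f 0) := by
  let h : ∀ i j : ℤ, (ComplexShape.up ℤ).Rel j i → (A.X i ⟶ X.X j) := fun i j hij =>
    eqToHom (congrArg A.X hij.symm) ≫ ModuleCat.ofHom (s j)
  have hh : ∀ n hn, h (n + 1) n hn = ModuleCat.ofHom (s n) := fun n hn => by simp [h]
  refine ⟨(Homotopy.ofEq ?_).trans (Homotopy.nullHomotopy' h)⟩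
  ext n x
  obtain ⟨n, rfl⟩ : ∃ m, n = m + 1 := ⟨n - 1, by omega⟩
  rw [Homotopy.nullHomotopicMap'_f (k₂ := n) (k₀ := n + 1 + 1) rfl rfl, hh n rfl, hh (n + 1) rfl]
  exact (hs n x).trans (add_comm _ _)

end Complexes

end Modules

theorem statement2 {R : Type u} [Ring R] (S : Set (ModuleCat.{u} Rᵐᵒᵖ))
    (hfp : ∀ M ∈ S, Module.FinitePresentation Rᵐᵒᵖ M)
    (hfree : ModuleCat.of Rᵐᵒᵖ Rᵐᵒᵖ ∈ S)
    (hext : ClosedUnderExtensions S)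
    (hker : ClosedUnderKernelsOfEpis S)
    (B A C : Set (ModuleCat.{u} Rᵐᵒᵖ))
    (hB : B = rightPerp S) (hA : A = leftPerp B) (hC : C = limClosure S)
    (Acx Xcx : CochainComplex (ModuleCat.{u} Rᵐᵒᵖ) ℤ)
    (hAterms : ∀ n : ℤ, Acx.X n ∈ A)
    (hacyclic : IsAcyclic Xcx)
    (hXterms : ∀ n : ℤ, Xcx.X n ∈ B ∩ C)
    (hXcocycles : ∀ n : ℤ, kernel (Xcx.d n (n + 1)) ∈ B ∩ C)
    (f : Acx ⟶ Xcx) :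
    Nonempty (Homotopy f 0) := by
  subst hB hA hC
  have hS := admissible_of_closed hfp hfree hext hker
  have hcomm : ∀ n x, (Xcx.d (n + 1) (n + 1 + 1)).hom ((f.f (n + 1)).hom x) =
      (f.f (n + 1 + 1)).hom ((Acx.d (n + 1) (n + 1 + 1)).hom x) :=
    fun n x => congr($(f.comm (n + 1) (n + 1 + 1)).hom x)
  obtain ⟨s, hs⟩ := (isPureAcyclic_of_isAcyclic hacyclic hXcocycles).exists_homotopy_of_mem_leftPerp
    hS (A := fun n => Acx.X (n + 1)) (dA := fun n => (Acx.d (n + 1) (n + 1 + 1)).hom)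
    (f := fun n => (f.f (n + 1)).hom) (fun n => hAterms (n + 1))
    (fun n x => congr($(Xcx.d_comp_d n (n + 1) (n + 1 + 1)).hom x)) (fun n => (hXterms n).1)
    (fun n x => congr($(Acx.d_comp_d (n + 1) (n + 1 + 1) (n + 1 + 1 + 1)).hom x)) hcomm
  exact nonempty_homotopy_zero f s hs

end GenPeriodicity
end

section
/- Let R be a ring and S a class of finitely presented right R-modules containing the free module R and closed under extensions and kernels of epimorphisms. Put C = lim→ S. Let 0 → B → L → C → 0 be a short exact sequence of right R-modules with C ∈ C and B ∈ S^{⊥₁}. Then this short exact sequence is pure. -/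
open CategoryTheory CategoryTheory.Limits

universe w v u

namespace GenPeriodicity

variable {K : Type u} [Category.{v} K]

section Lifting

variable [Abelian K]

/-- If `Ext¹(X, B) = 0`, then every morphism from `X` lifts along an epimorphism with kernel `B`. -/
theorem Ext1Zero.exists_lift_s3 {X B L M : K} (hX : Ext1Zero X B) {i : B ⟶ L} {p : L ⟶ M}
    {w : i ≫ p = 0} (hse : (ShortComplex.mk i p w).ShortExact) (f : X ⟶ M) :
    ∃ l : X ⟶ L, l ≫ p = f := by
  have : Epi p := hse.epi_g
  have : Mono i := hse.mono_f
  have hlift : pullback.lift i 0 (by simp [w]) ≫ pullback.fst p f = i := pullback.lift_fst _ _ _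
  have : Mono (pullback.lift i (0 : B ⟶ X) (by simp [w]) : B ⟶ pullback p f) :=
    have : Mono (pullback.lift i 0 (by simp [w]) ≫ pullback.fst p f) := by rwa [hlift]
    mono_of_mono _ (pullback.fst p f)
  have hsnd : pullback.lift i 0 (by simp [w]) ≫ pullback.snd p f = 0 := pullback.lift_snd _ _ _
  have hexact : (ShortComplex.mk _ _ hsnd).ShortExact :=
    { exact := ShortComplex.exact_of_f_is_kernel _ (KernelFork.IsLimit.ofι' _ _ fun {A} k hk =>
        ⟨hse.exact.lift (k ≫ pullback.fst p f) (by
            simp only [Category.assoc, pullback.condition, reassoc_of% hk, zero_comp]), by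
          apply pullback.hom_ext
          · rw [Category.assoc, hlift]
            exact hse.exact.lift_f _ _
          · simp only [Category.assoc, hsnd, comp_zero]
            exact hk.symm⟩)
      mono_f := this
      epi_g := inferInstanceAs (Epi (pullback.snd p f)) }
  obtain ⟨s, hs⟩ := hX _ _ _ hsnd hexact
  exact ⟨s ≫ pullback.fst p f, by rw [Category.assoc, pullback.condition, reassoc_of% hs]⟩

end Lifting

section FilteredColimits

variable {A : Type u} [Ring A] {J : Type u} [SmallCategory J] [IsFiltered J]
  {F : J ⥤ ModuleCat.{u} A} {c : Cocone F}

/-- A morphism from a finite free module to a filtered colimit factors through some stage. -/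
theorem exists_fin_factorization (hc : IsColimit c) {n : ℕ} (g : (Fin n → A) →ₗ[A] c.pt) :
    ∃ (j : J) (φ : (Fin n → A) →ₗ[A] F.obj j), (c.ι.app j).hom ∘ₗ φ = g := by
  classical
  choose j x hx using fun k : Fin n =>
    Concrete.isColimit_exists_rep F hc (g (Pi.single k 1))
  obtain ⟨m, hm⟩ := IsFiltered.sup_objs_exists (Finset.univ.image j)
  let f (k : Fin n) : j k ⟶ m := (hm (Finset.mem_image_of_mem j (Finset.mem_univ k))).some
  refine ⟨m, (Pi.basisFun A (Fin n)).constr ℕ fun k => F.map (f k) (x k),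
    (Pi.basisFun A (Fin n)).ext fun k => ?_⟩
  rw [LinearMap.comp_apply, Module.Basis.constr_basis, Pi.basisFun_apply, ← hx k]
  exact ConcreteCategory.congr_hom (c.w (f k)) (x k)

/-- A morphism from a finite free module to a stage of a filtered colimit that vanishes in the
colimit already vanishes at a later stage. -/
theorem exists_map_comp_eq_zero (hc : IsColimit c) {n : ℕ} {j : J}
    (φ : (Fin n → A) →ₗ[A] F.obj j) (hφ : (c.ι.app j).hom ∘ₗ φ = 0) :
    ∃ (m : J) (f : j ⟶ m), (F.map f).hom ∘ₗ φ = 0 := by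
  have hzero (x : F.obj j) (hx : (c.ι.app j).hom x = 0) :
      ∃ (m : J) (f : j ⟶ m), (F.map f).hom x = 0 := by
    obtain ⟨k, a, b, hab⟩ := Concrete.isColimit_exists_of_rep_eq F hc x (0 : F.obj j)
      (hx.trans (map_zero (c.ι.app j).hom).symm)
    exact ⟨k, a, hab.trans (map_zero (F.map b).hom)⟩
  choose t a ha using fun k : Fin n =>
    hzero (φ (Pi.single k 1)) (LinearMap.congr_fun hφ (Pi.single k 1))
  obtain ⟨m, f, b, hb⟩ := IsFiltered.wideSpan a
  refine ⟨m, f, (Pi.basisFun A (Fin n)).ext fun k => ?_⟩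
  rw [Pi.basisFun_apply, LinearMap.comp_apply, ← hb k, F.map_comp, ModuleCat.hom_comp,
    LinearMap.comp_apply, ha k, map_zero, LinearMap.zero_apply]

/-- A morphism from a finitely presented module to a filtered colimit factors through some
stage. -/
theorem exists_factorization_of_finitePresentation (hc : IsColimit c) (T : ModuleCat.{u} A)
    [Module.FinitePresentation A T] (g : T ⟶ c.pt) :
    ∃ (j : J) (φ : T ⟶ F.obj j), φ ≫ c.ι.app j = g := by
  obtain ⟨n, m, π, r, hπ, hr⟩ := Module.FinitePresentation.exists_fin' A T
  obtain ⟨j, φ, hφ⟩ := exists_fin_factorization hc (g.hom ∘ₗ π)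
  obtain ⟨k, f, hf⟩ := exists_map_comp_eq_zero hc (φ ∘ₗ r) (by
    rw [← LinearMap.comp_assoc, hφ, LinearMap.comp_assoc, hr.linearMap_comp_eq_zero,
      LinearMap.comp_zero])
  have hker : LinearMap.ker π ≤ LinearMap.ker ((F.map f).hom ∘ₗ φ) := by
    rw [hr.linearMap_ker_eq]
    rintro _ ⟨y, rfl⟩
    exact LinearMap.congr_fun hf y
  let e := π.quotKerEquivOfSurjective hπ
  refine ⟨k, ModuleCat.ofHom ((LinearMap.ker π).liftQ _ hker ∘ₗ e.symm), ?_⟩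
  ext x
  obtain ⟨y, rfl⟩ := hπ x
  have hy : e.symm (π y) = (LinearMap.ker π).mkQ y := by
    rw [LinearEquiv.symm_apply_eq]
    rfl
  have hw := ConcreteCategory.congr_hom (c.w f) (φ y)
  simp only [ModuleCat.hom_comp, ModuleCat.hom_ofHom, LinearMap.comp_apply,
    LinearEquiv.coe_coe, hy, Submodule.mkQ_apply, Submodule.liftQ_apply]
  exact hw.trans (LinearMap.congr_fun hφ y)

end FilteredColimits

theorem statement3 {R : Type u} [Ring R] (S : Set (ModuleCat.{u} Rᵐᵒᵖ))
    (hfp : ∀ M ∈ S, Module.FinitePresentation Rᵐᵒᵖ M)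
    (hfree : ModuleCat.of Rᵐᵒᵖ Rᵐᵒᵖ ∈ S)
    (hext : ClosedUnderExtensions S)
    (hker : ClosedUnderKernelsOfEpis S)
    (C : Set (ModuleCat.{u} Rᵐᵒᵖ)) (hC : C = limClosure S)
    (B L M : ModuleCat.{u} Rᵐᵒᵖ) (i : B ⟶ L) (p : L ⟶ M) (w : i ≫ p = 0)
    (hse : (ShortComplex.mk i p w).ShortExact)
    (hM : M ∈ C) (hB : B ∈ rightPerp S) :
    ∀ T : ModuleCat.{u} Rᵐᵒᵖ, Module.FinitePresentation Rᵐᵒᵖ T →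
      (Function.Injective fun g : T ⟶ B => g ≫ i) ∧
      (∀ h : T ⟶ L, h ≫ p = 0 ↔ ∃ g : T ⟶ B, g ≫ i = h) ∧
      (Function.Surjective fun h : T ⟶ L => h ≫ p) := by
  intro T hT
  have : Mono i := hse.mono_f
  refine ⟨fun a b hab => (cancel_mono i).mp hab, fun h => ⟨fun hh => ?_, ?_⟩, fun g => ?_⟩
  · exact ⟨hse.exact.lift h hh, hse.exact.lift_f h hh⟩
  · rintro ⟨g, rfl⟩
    rw [Category.assoc, w, comp_zero]
  · subst hC
    obtain ⟨D⟩ := hM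
    let := D.po
    have := D.dir
    have := D.ne
    obtain ⟨j, φ, hφ⟩ := exists_factorization_of_finitePresentation D.hc T (g ≫ D.iso.inv)
    obtain ⟨l, hl⟩ := (hB _ (D.mem j)).exists_lift_s3 hse (D.c.ι.app j ≫ D.iso.hom)
    refine ⟨φ ≫ l, ?_⟩
    change (φ ≫ l) ≫ p = g
    rw [Category.assoc, hl, reassoc_of% hφ, Iso.inv_hom_id, Category.comp_id]

end GenPeriodicity
end
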